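/- Let (𝒫, 𝒩) be a Beurling generalized number system whose integers are θ-well-behaved for some θ ∈ [0,1). Then there is a constant C (depending only on the system) such that uniformly for all α with (1+θ)/2 ≤ α ≤ 1 and all T ≥ 2, N(ζ_𝒫; α, T) ≤ C · T^{4(1−α)/(3−2α−θ)} (log T)^9. -/

import Mathlib

open Filter Asymptotics

/-- A Beurling generalized number system: a nondecreasing sequence of generalized
primes `p` with `1 < p 0` tending to infinity, together with the nondecreasing
enumeration `n` (with multiplicity) of all finite products of the generalized primes,
witnessed by the bijection `equiv` from exponent vectors to indices. -/
structure BeurlingSystem where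
  p : ℕ → ℝ
  n : ℕ → ℝ
  one_lt_p : 1 < p 0
  mono_p : Monotone p
  tendsto_p : Tendsto p atTop atTop
  mono_n : Monotone n
  equiv : (ℕ →₀ ℕ) ≃ ℕ
  n_eq : ∀ k : ℕ →₀ ℕ, n (equiv k) = ∏ j ∈ k.support, p j ^ k j

/-- The integer counting function `N_𝒫(x)`. -/
noncomputable def BeurlingSystem.Nint (S : BeurlingSystem) (x : ℝ) : ℕ :=
  {j : ℕ | S.n j ≤ x}.ncard

/-- `Z` is an analytic continuation of the Beurling zeta function of the system `S`
to the half-plane `Re s > θ`, with density `A`: it agrees with the Dirichlet series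
on `Re s > 1` and `Z s - A/(s-1)` is analytic on `Re s > θ`. -/
def BeurlingSystem.IsZeta (S : BeurlingSystem) (θ A : ℝ) (Z : ℂ → ℂ) : Prop :=
  (∀ s : ℂ, 1 < s.re → Z s = ∑' j : ℕ, (S.n j : ℂ) ^ (-s)) ∧
    DifferentiableOn ℂ (fun s => Z s - (A : ℂ) / (s - 1)) {s : ℂ | θ < s.re}

/-- The number of zeros (without multiplicity) of `Z` with `α ≤ Re ρ` and `|Im ρ| ≤ T`. -/
noncomputable def zeroCount (Z : ℂ → ℂ) (α T : ℝ) : ℕ :=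
  {ρ : ℂ | Z ρ = 0 ∧ α ≤ ρ.re ∧ |ρ.im| ≤ T}.ncard

section Fourier

open MeasureTheory Complex Real

theorem integral_norm_sq_fourier_mul_gaussian_le {g : ℝ → ℂ} (hg : Integrable g)
    (hg2 : Integrable fun y => ‖g y‖ ^ 2) {b : ℝ} (hb : 0 < b) :
    ∫ t : ℝ, ‖∫ y, g y * cexp (-(t * y) * I)‖ ^ 2 * rexp (-b * t ^ 2)
      ≤ 2 * π * ∫ y, ‖g y‖ ^ 2 := by
  set K : ℝ → ℝ := fun u => √(π / b) * rexp (-(1 / (4 * b)) * u ^ 2) with hK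
  have hb4 : 0 < 1 / (4 * b) := by positivity
  have hKint : Integrable K := (integrable_exp_neg_mul_sq hb4).const_mul _
  have hKval : ∫ u, K u = 2 * π := by
    simp only [hK]
    rw [integral_const_mul, integral_gaussian, ← Real.sqrt_mul (by positivity)]
    rw [show π / b * (π / (1 / (4 * b))) = (2 * π) ^ 2 by field_simp; ring]
    exact Real.sqrt_sq (by positivity)
  have hKnn : ∀ u, 0 ≤ K u := fun u => by simp only [hK]; positivity
  have hgg : Integrable (fun z : ℝ × ℝ => g z.1 * (starRingEnd ℂ) (g z.2))
      (volume.prod volume) := by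
    have hc : Integrable (fun y => (starRingEnd ℂ) (g y)) :=
      (LinearIsometryEquiv.integrable_comp_iff (Complex.conjLIE)).2 hg
    exact hg.mul_prod hc
  have hgauss : Integrable fun t : ℝ => cexp (-b * t ^ 2) :=
    integrable_cexp_neg_mul_sq (by simpa using hb)
  have hsq : ∀ t : ℝ, (((‖∫ y, g y * cexp (-(t * y) * I)‖ ^ 2 * rexp (-b * t ^ 2) : ℝ)) : ℂ) =
      ∫ z : ℝ × ℝ, (g z.1 * (starRingEnd ℂ) (g z.2)) *
        (cexp (I * (-(z.1 - z.2)) * t) * cexp (-b * t ^ 2)) ∂(volume.prod volume) := by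
    intro t
    have : (((‖∫ y, g y * cexp (-(t * y) * I)‖ ^ 2 : ℝ)) : ℂ) =
        (∫ y, g y * cexp (-(t * y) * I)) * ∫ y, (starRingEnd ℂ) (g y * cexp (-(t * y) * I)) := by
      rw [integral_conj, Complex.mul_conj, Complex.normSq_eq_norm_sq]
    rw [Complex.ofReal_mul, this, ← integral_prod_mul, ← integral_mul_const]
    congr 1
    ext z
    rw [map_mul, ← Complex.exp_conj]
    simp only [map_mul, map_neg, conj_I, conj_ofReal]
    rw [show I * (-((z.1 : ℂ) - z.2)) * t = -(t * z.1) * I + -(t * z.2) * -I by ring,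
      Complex.exp_add]
    push_cast
    ring
  have hint3 : Integrable (fun p : ℝ × (ℝ × ℝ) => (g p.2.1 * (starRingEnd ℂ) (g p.2.2)) *
        (cexp (I * (-(p.2.1 - p.2.2)) * p.1) * cexp (-b * p.1 ^ 2)))
        (volume.prod (volume.prod volume)) := by
    have h1 := hgauss.mul_prod hgg
    refine (h1.bdd_mul (c := 1) (f := fun p : ℝ × (ℝ × ℝ) =>
      cexp (I * (-(p.2.1 - p.2.2)) * p.1)) ?_ ?_).congr ?_
    · exact (by fun_prop : Continuous _).aestronglyMeasurable
    · refine Eventually.of_forall fun p => ?_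
      rw [show I * (-((p.2.1 : ℂ) - p.2.2)) * p.1 = ((-(p.2.1 - p.2.2) * p.1 : ℝ) : ℂ) * I by
        push_cast; ring, Complex.norm_exp_ofReal_mul_I]
    · refine Eventually.of_forall fun p => ?_
      simp only
      ring
  have hmain : ((∫ t : ℝ, ‖∫ y, g y * cexp (-(t * y) * I)‖ ^ 2 * rexp (-b * t ^ 2) : ℝ) : ℂ) =
      ∫ z : ℝ × ℝ, (g z.1 * (starRingEnd ℂ) (g z.2)) * (K (z.1 - z.2) : ℂ)
        ∂(volume.prod volume) := by
    rw [← integral_complex_ofReal]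
    simp_rw [hsq]
    rw [integral_integral_swap hint3]
    congr 1
    ext z
    rw [integral_const_mul, fourierIntegral_gaussian (by simpa using hb)]
    congr 1
    simp only [hK]
    push_cast
    congr 1
    · rw [Real.sqrt_eq_rpow, Complex.ofReal_cpow (by positivity)]
      push_cast
      ring_nf
    · congr 1
      field_simp
  have hconv : Integrable (fun z : ℝ × ℝ => ‖g z.1‖ ^ 2 * K (z.1 - z.2))
      (volume.prod volume) := by
    have := (hg2.convolution_integrand (ContinuousLinearMap.mul ℝ ℝ) hKint).swap
    refine this.congr (Eventually.of_forall fun z => ?_)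
    simp only [Function.comp, Prod.swap, ContinuousLinearMap.mul_apply', hK]
    congr 3
    ring
  have hconv' : Integrable (fun z : ℝ × ℝ => ‖g z.2‖ ^ 2 * K (z.1 - z.2))
      (volume.prod volume) := by
    have := (hg2.convolution_integrand (ContinuousLinearMap.mul ℝ ℝ) hKint)
    exact this.congr (Eventually.of_forall fun z => by simp)
  have hv : ∫ z : ℝ × ℝ, ‖g z.1‖ ^ 2 * K (z.1 - z.2) ∂(volume.prod volume) =
      2 * π * ∫ y, ‖g y‖ ^ 2 := by
    rw [integral_prod _ hconv]
    simp only [integral_const_mul]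
    have : ∀ x : ℝ, ∫ y, K (x - y) = 2 * π := fun x => by
      rw [integral_sub_left_eq_self K volume x, hKval]
    simp only [this]
    rw [integral_mul_const, mul_comm]
  have hv' : ∫ z : ℝ × ℝ, ‖g z.2‖ ^ 2 * K (z.1 - z.2) ∂(volume.prod volume) =
      2 * π * ∫ y, ‖g y‖ ^ 2 := by
    rw [integral_prod_symm _ hconv']
    simp only [integral_const_mul]
    have : ∀ y : ℝ, ∫ x, K (x - y) = 2 * π := fun x => by
      rw [integral_sub_right_eq_self K x, hKval]
    simp only [this]
    rw [integral_mul_const, mul_comm]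
  calc _ ≤ ‖((∫ t : ℝ, ‖∫ y, g y * cexp (-(t * y) * I)‖ ^ 2 * rexp (-b * t ^ 2) : ℝ) : ℂ)‖ := by
        rw [Complex.norm_real]; exact le_abs_self _
    _ ≤ ∫ z : ℝ × ℝ, ‖(g z.1 * (starRingEnd ℂ) (g z.2)) * (K (z.1 - z.2) : ℂ)‖
        ∂(volume.prod volume) := by
        rw [hmain]; exact norm_integral_le_integral_norm _
    _ ≤ ∫ z : ℝ × ℝ, (1 / 2) * (‖g z.1‖ ^ 2 * K (z.1 - z.2) + ‖g z.2‖ ^ 2 * K (z.1 - z.2))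
        ∂(volume.prod volume) := by
        refine integral_mono_of_nonneg (Eventually.of_forall fun z => norm_nonneg _)
          ((hconv.add hconv').const_mul _) (Eventually.of_forall fun z => ?_)
        simp only [norm_mul, RCLike.norm_conj, Complex.norm_real, Real.norm_eq_abs,
          abs_of_nonneg (hKnn _)]
        nlinarith [mul_nonneg (sq_nonneg (‖g z.1‖ - ‖g z.2‖)) (hKnn (z.1 - z.2))]
    _ = 2 * π * ∫ y, ‖g y‖ ^ 2 := by
        rw [integral_const_mul, integral_add hconv hconv', hv, hv']; ring

theorem continuous_fourier_integral {g : ℝ → ℂ} (hg : Integrable g) :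
    Continuous fun t : ℝ => ∫ y, g y * cexp (-(t * y) * I) := by
  refine continuous_of_dominated (bound := fun y => ‖g y‖) ?_ ?_ hg.norm ?_
  · intro t
    exact hg.aestronglyMeasurable.mul (by fun_prop : Continuous _).aestronglyMeasurable
  · intro t
    refine Eventually.of_forall fun y => ?_
    rw [norm_mul, show -((t : ℂ) * y) * I = ((-(t * y) : ℝ) : ℂ) * I by push_cast; ring,
      Complex.norm_exp_ofReal_mul_I, mul_one]
  · exact Eventually.of_forall fun y => by fun_prop

/-- A truncated form of Bessel's inequality for the Fourier transform. -/
theorem integral_norm_sq_fourier_le {g : ℝ → ℂ} (hg : Integrable g)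
    (hg2 : Integrable fun y => ‖g y‖ ^ 2) {T : ℝ} (hT : 0 < T) :
    ∫ t in -T..T, ‖∫ y, g y * cexp (-(t * y) * I)‖ ^ 2
      ≤ 2 * π * rexp 1 * ∫ y, ‖g y‖ ^ 2 := by
  have hb : 0 < 1 / T ^ 2 := by positivity
  have h := integral_norm_sq_fourier_mul_gaussian_le hg hg2 hb
  set G : ℝ → ℂ := fun t => ∫ y, g y * cexp (-(t * y) * I) with hG
  have hGc : Continuous G := continuous_fourier_integral hg
  have hGb : ∀ t, ‖G t‖ ≤ ∫ y, ‖g y‖ := by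
    intro t
    refine (norm_integral_le_integral_norm _).trans_eq ?_
    congr 1
    ext y
    rw [norm_mul, show -((t : ℂ) * y) * I = ((-(t * y) : ℝ) : ℂ) * I by push_cast; ring,
      Complex.norm_exp_ofReal_mul_I, mul_one]
  have hint : Integrable fun t : ℝ => ‖G t‖ ^ 2 * rexp (-(1 / T ^ 2) * t ^ 2) := by
    refine (integrable_exp_neg_mul_sq hb).bdd_mul (c := (∫ y, ‖g y‖) ^ 2) ?_ ?_
    · exact (by fun_prop : Continuous _).aestronglyMeasurable
    · refine Eventually.of_forall fun t => ?_
      rw [norm_pow, norm_norm]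
      gcongr
      exact hGb t
  calc ∫ t in -T..T, ‖G t‖ ^ 2
      ≤ ∫ t in -T..T, rexp 1 * (‖G t‖ ^ 2 * rexp (-(1 / T ^ 2) * t ^ 2)) := by
        refine intervalIntegral.integral_mono_on (by linarith)
          ((by fun_prop : Continuous _).intervalIntegrable _ _)
          ((by fun_prop : Continuous _).intervalIntegrable _ _) ?_
        intro t ht
        have h1 : t ^ 2 ≤ T ^ 2 := sq_le_sq' ht.1 ht.2
        have h2 : 1 ≤ rexp 1 * rexp (-(1 / T ^ 2) * t ^ 2) := by
          rw [← Real.exp_add]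
          apply Real.one_le_exp
          have : t ^ 2 / T ^ 2 ≤ 1 := by rw [div_le_one (by positivity)]; exact h1
          have h3 : (1 / T ^ 2) * t ^ 2 = t ^ 2 / T ^ 2 := by ring
          linarith
        nlinarith [sq_nonneg ‖G t‖]
    _ ≤ rexp 1 * ∫ t, ‖G t‖ ^ 2 * rexp (-(1 / T ^ 2) * t ^ 2) := by
        rw [intervalIntegral.integral_const_mul, intervalIntegral.integral_of_le (by linarith)]
        exact mul_le_mul_of_nonneg_left
          (setIntegral_le_integral hint (Eventually.of_forall fun t => by positivity))
          (Real.exp_pos _).le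
    _ ≤ rexp 1 * (2 * π * ∫ y, ‖g y‖ ^ 2) := by gcongr
    _ = _ := by ring

end Fourier

section ContourAndJensen

open MeasureTheory Complex Real

theorem log_neg_of_im_pos {z : ℂ} (h : 0 < z.im) : Complex.log (-z) = Complex.log z - π * I := by
  simp only [Complex.log, norm_neg, Complex.arg_neg_eq_arg_sub_pi_of_im_pos h]
  push_cast; ring

theorem log_neg_of_im_neg {z : ℂ} (h : z.im < 0) : Complex.log (-z) = Complex.log z + π * I := by
  simp only [Complex.log, norm_neg, Complex.arg_neg_eq_arg_add_pi_of_im_neg h]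
  push_cast; ring

theorem integral_inv_horizontal {a b : ℝ} {w : ℂ} (h : w.im ≠ 0) :
    ∫ x in a..b, ((x : ℂ) + w)⁻¹ = Complex.log (b + w) - Complex.log (a + w) := by
  have hs : ∀ x : ℝ, (x : ℂ) + w ∈ slitPlane := fun x => Or.inr (by simpa using h)
  have hne : ∀ x : ℝ, (x : ℂ) + w ≠ 0 := fun x => slitPlane_ne_zero (hs x)
  refine intervalIntegral.integral_eq_sub_of_hasDerivAt (f := fun x : ℝ => Complex.log (x + w)) ?_ ?_
  · intro x _
    have h1 : HasDerivAt (fun y : ℝ => (y : ℂ) + w) 1 x := by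
      simpa using (Complex.ofRealCLM.hasDerivAt (x := x)).add_const w
    simpa using h1.clog_real (hs x)
  · apply Continuous.intervalIntegrable
    exact Continuous.inv₀ (by fun_prop) hne

theorem integral_inv_vertical {c d : ℝ} {w : ℂ} (h : 0 < w.re) :
    I * ∫ y in c..d, ((y : ℂ) * I + w)⁻¹ = Complex.log (d * I + w) - Complex.log (c * I + w) := by
  have hs : ∀ x : ℝ, (x : ℂ) * I + w ∈ slitPlane := fun x => Or.inl (by simpa using h)
  have hne : ∀ x : ℝ, (x : ℂ) * I + w ≠ 0 := fun x => slitPlane_ne_zero (hs x)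
  rw [← intervalIntegral.integral_const_mul]
  refine intervalIntegral.integral_eq_sub_of_hasDerivAt
    (f := fun x : ℝ => Complex.log (x * I + w)) ?_ ?_
  · intro x _
    have h1 : HasDerivAt (fun y : ℝ => (y : ℂ) * I + w) I x := by
      simpa using ((Complex.ofRealCLM.hasDerivAt (x := x)).mul_const I).add_const w
    simpa [div_eq_mul_inv] using h1.clog_real (hs x)
  · apply Continuous.intervalIntegrable
    exact continuous_const.mul (Continuous.inv₀ (by fun_prop) hne)

theorem integral_boundary_rect_inv {a b c d : ℝ} {ρ : ℂ} (ha : a < ρ.re) (hb : ρ.re < b)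
    (hc : c < ρ.im) (hd : ρ.im < d) :
    (∫ x in a..b, ((x : ℂ) + c * I - ρ)⁻¹) - (∫ x in a..b, ((x : ℂ) + d * I - ρ)⁻¹) +
      I * (∫ y in c..d, ((b : ℂ) + y * I - ρ)⁻¹) - I * (∫ y in c..d, ((a : ℂ) + y * I - ρ)⁻¹) =
      2 * π * I := by
  have e1 := integral_inv_horizontal (a := a) (b := b) (w := c * I - ρ)
    (by simp; linarith)
  have e2 := integral_inv_horizontal (a := a) (b := b) (w := d * I - ρ)
    (by simp; linarith)
  have e3 := integral_inv_vertical (c := c) (d := d) (w := b - ρ) (by simpa using hb)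
  have e4 := integral_inv_vertical (c := -c) (d := -d) (w := -(a - ρ)) (by simpa using ha)
  have e4' : I * (∫ y in c..d, ((a : ℂ) + y * I - ρ)⁻¹) =
      Complex.log (-(a + d * I - ρ)) - Complex.log (-(a + c * I - ρ)) := by
    have : ∫ y in c..d, ((a : ℂ) + y * I - ρ)⁻¹ =
        ∫ y in (-c)..(-d), ((y : ℂ) * I + -(a - ρ))⁻¹ := by
      rw [← intervalIntegral.integral_comp_neg (fun y : ℝ => ((y : ℂ) * I + -(a - ρ))⁻¹)]
      rw [intervalIntegral.integral_symm d c,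
        ← intervalIntegral.integral_neg]
      congr 1
      ext y
      rw [← inv_neg]
      push_cast
      congr 1
      ring
    rw [this, e4]
    push_cast
    congr 2 <;> ring
  have f1 : ∀ (u v : ℝ), (u : ℂ) + (v * I - ρ) = u + v * I - ρ := fun u v => by ring
  have f2 : ∀ (u v : ℝ), (v : ℂ) * I + (u - ρ) = u + v * I - ρ := fun u v => by ring
  simp only [f1] at e1 e2
  simp only [f2] at e3
  rw [e1, e2, e3, e4', log_neg_of_im_pos (z := a + d * I - ρ) (by simp; linarith),
    log_neg_of_im_neg (z := a + c * I - ρ) (by simp; linarith)]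
  ring

/-- Cauchy's integral formula for a rectangle. -/
theorem integral_boundary_rect_div_sub {g : ℂ → ℂ} {a b c d : ℝ} {ρ : ℂ} (ha : a < ρ.re)
    (hb : ρ.re < b) (hc : c < ρ.im) (hd : ρ.im < d)
    (hg : ∀ z : ℂ, a ≤ z.re → DifferentiableAt ℂ g z) :
    (∫ x in a..b, g (x + c * I) / ((x : ℂ) + c * I - ρ)) -
      (∫ x in a..b, g (x + d * I) / ((x : ℂ) + d * I - ρ)) +
      I * (∫ y in c..d, g (b + y * I) / ((b : ℂ) + y * I - ρ)) -
      I * (∫ y in c..d, g (a + y * I) / ((a : ℂ) + y * I - ρ)) = 2 * π * I * g ρ := by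
  have hds : ∀ z : ℂ, a ≤ z.re → z ≠ ρ → DifferentiableAt ℂ (dslope g ρ) z := fun z hz hne =>
    (differentiableAt_dslope_of_ne hne).2 (hg z hz)
  have key := Complex.integral_boundary_rect_eq_zero_of_differentiable_on_off_countable
    (dslope g ρ) (a + c * I) (b + d * I) {ρ} (Set.countable_singleton _) ?_ ?_
  · simp only [add_re, ofReal_re, mul_re, I_re, mul_zero, ofReal_im, I_im, mul_one, sub_self,
      add_zero, add_im, mul_im, zero_add, smul_eq_mul] at key
    have hev : ∀ z : ℂ, z ≠ ρ → dslope g ρ z = g z / (z - ρ) - g ρ * (z - ρ)⁻¹ := fun z hz => by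
      rw [dslope_of_ne _ hz, slope_def_field]; ring
    have n1 : ∀ x : ℝ, (x : ℂ) + c * I ≠ ρ := fun x h => by
      have := congrArg Complex.im h; simp at this; linarith
    have n2 : ∀ x : ℝ, (x : ℂ) + d * I ≠ ρ := fun x h => by
      have := congrArg Complex.im h; simp at this; linarith
    have n3 : ∀ y : ℝ, (b : ℂ) + y * I ≠ ρ := fun x h => by
      have := congrArg Complex.re h; simp at this; linarith
    have n4 : ∀ y : ℝ, (a : ℂ) + y * I ≠ ρ := fun x h => by
      have := congrArg Complex.re h; simp at this; linarith
    have hinv : ∀ (p : ℝ → ℂ), Continuous p → (∀ x, p x ≠ ρ) → ∀ u v : ℝ,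
        IntervalIntegrable (fun x => g ρ * (p x - ρ)⁻¹) volume u v := fun p hp hne u v =>
      (continuous_const.mul (Continuous.inv₀ (by fun_prop)
        (fun x => sub_ne_zero.2 (hne x)))).intervalIntegrable _ _
    have hgi : ∀ (p : ℝ → ℂ), Continuous p → (∀ x, p x ≠ ρ) → ∀ u v : ℝ, 
        (∀ x ∈ Set.uIcc u v, a ≤ (p x).re) →
        IntervalIntegrable (fun x => g (p x) / (p x - ρ)) volume u v := by
      intro p hp hne u v hre
      refine ContinuousOn.intervalIntegrable (ContinuousOn.div ?_ (by fun_prop)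
        (fun x _ => sub_ne_zero.2 (hne x)))
      intro x hx
      exact ((hg _ (hre x hx)).continuousAt.comp hp.continuousAt).continuousWithinAt
    have hab : a ≤ b := by linarith
    have hI : ∀ (p : ℝ → ℂ), Continuous p → (∀ x, p x ≠ ρ) → ∀ u v : ℝ, 
        (∀ x ∈ Set.uIcc u v, a ≤ (p x).re) → ∫ x in u..v, dslope g ρ (p x) =
        (∫ x in u..v, g (p x) / (p x - ρ)) - g ρ * ∫ x in u..v, (p x - ρ)⁻¹ := by
      intro p hp hne u v hre
      rw [← intervalIntegral.integral_const_mul, ← intervalIntegral.integral_sub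
        (hgi p hp hne u v hre) (hinv p hp hne u v)]
      congr 1
      ext x
      rw [hev _ (hne x)]
    rw [hI (fun x => x + c * I) (by fun_prop) n1 _ _ (fun x hx => by
        rw [Set.uIcc_of_le hab] at hx; simpa using hx.1),
      hI (fun x => x + d * I) (by fun_prop) n2 _ _ (fun x hx => by
        rw [Set.uIcc_of_le hab] at hx; simpa using hx.1),
      hI (fun x => b + x * I) (by fun_prop) n3 _ _ (fun x hx => by simpa using hab),
      hI (fun x => a + x * I) (by fun_prop) n4 _ _ (fun x hx => by simp)] at key
    have := integral_boundary_rect_inv ha hb hc hd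
    linear_combination key + g ρ * this
  · intro z hz
    have hz' : a ≤ z.re := by
      have := (Complex.mem_reProdIm.1 hz).1
      simp only [add_re, ofReal_re, mul_re, I_re, mul_zero, ofReal_im, I_im, mul_one, sub_self,
        add_zero] at this
      rw [Set.uIcc_of_le (by linarith)] at this
      exact this.1
    by_cases h : z = ρ
    · subst h
      exact (continuousAt_dslope_same.2 (hg _ hz')).continuousWithinAt
    · exact (hds z hz' h).continuousAt.continuousWithinAt
  · intro z hz
    have hz' : a ≤ z.re := by
      have := (Complex.mem_reProdIm.1 hz.1).1
      simp only [add_re, ofReal_re, mul_re, I_re, mul_zero, ofReal_im, I_im, mul_one, sub_self,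
        add_zero] at this
      rw [min_eq_left (by linarith)] at this
      exact this.1.le
    exact hds z hz' hz.2

/-- A bound for the number of zeros in a disc, from Jensen's inequality. -/
theorem card_zeros_le {f : ℂ → ℂ} {c : ℂ} {r R M : ℝ} (hr : 0 < r) (hrR : r < R) (hM : 1 ≤ M)
    (hf : AnalyticOnNhd ℂ f (Metric.closedBall c R)) (hc : f c ≠ 0)
    (hb : ∀ z ∈ Metric.sphere c R, ‖f z‖ ≤ M) (s : Finset ℂ)
    (hs : ∀ z ∈ s, z ∈ Metric.closedBall c r ∧ f z = 0) :
    (s.card : ℝ) ≤ Real.log (M / ‖f c‖) / Real.log (R / r) := by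
  have har : |r| = r := abs_of_pos hr
  have haR : |R| = R := abs_of_pos (hr.trans hrR)
  have h := AnalyticOnNhd.sum_divisor_le (c := c) (r := r) (R := R) (f := f) (M := M)
    (by rwa [har]) (by rwa [har, haR]) hM (by rwa [haR]) hc (by rwa [haR])
  refine le_trans ?_ h
  rw [har]
  have hfr : AnalyticOnNhd ℂ f (Metric.closedBall c r) :=
    hf.mono (Metric.closedBall_subset_closedBall hrR.le)
  have hfin := (MeromorphicOn.divisor f (Metric.closedBall c r)).finiteSupport
    (isCompact_closedBall c r)
  have hfin' : (Function.support fun u => MeromorphicOn.divisor f (Metric.closedBall c r) u).Finite :=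
    hfin
  have hpre : IsPreconnected (Metric.closedBall c r) := (convex_closedBall c r).isPreconnected
  have hge : ∀ z ∈ s, 1 ≤ MeromorphicOn.divisor f (Metric.closedBall c r) z := by
    intro z hz
    obtain ⟨hz1, hz2⟩ := hs z hz
    rw [MeromorphicOn.AnalyticOnNhd.divisor_apply hfr hz1]
    have hnt : analyticOrderAt f z ≠ ⊤ := by
      intro htop
      have := hfr.eqOn_zero_of_preconnected_of_eventuallyEq_zero hpre hz1
        (analyticOrderAt_eq_top.1 htop)
      exact hc (this (Metric.mem_closedBall_self hr.le))
    have hne0 : analyticOrderAt f z ≠ 0 := by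
      intro h0
      exact ((hfr z hz1).analyticOrderAt_eq_zero.1 h0) hz2
    obtain ⟨n, hn⟩ := ENat.ne_top_iff_exists.1 hnt
    rw [← hn] at hne0 ⊢
    have : n ≠ 0 := by rintro rfl; simp at hne0
    simp
    omega
  have hss : s ⊆ hfin'.toFinset := by
    intro z hz
    rw [Set.Finite.mem_toFinset, Function.mem_support]
    have := hge z hz
    omega
  have hle : (s.card : ℤ) ≤ ∑ᶠ u, MeromorphicOn.divisor f (Metric.closedBall c r) u := by
    rw [finsum_eq_sum_of_support_subset _ (s := hfin'.toFinset) (by simp)]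
    calc (s.card : ℤ) = ∑ z ∈ s, 1 := by simp
      _ ≤ ∑ z ∈ s, MeromorphicOn.divisor f (Metric.closedBall c r) z := Finset.sum_le_sum hge
      _ ≤ _ := Finset.sum_le_sum_of_subset_of_nonneg hss
        (fun z _ _ => (MeromorphicOn.AnalyticOnNhd.divisor_nonneg hfr) z)
  exact_mod_cast hle

end ContourAndJensen

section LogSystems

open MeasureTheory Complex Real

/-- Logarithms `ℓ` of the generalized integers, indexed by exponent vectors, with counting
function `A * exp y + O(exp (θ * y))`. -/
structure LogSystem (ℓ : (ℕ →₀ ℕ) → ℝ) (θ A C : ℝ) : Prop where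
  theta_nonneg : 0 ≤ θ
  theta_lt_one : θ < 1
  A_pos : 0 < A
  C_nonneg : 0 ≤ C
  nonneg : ∀ k, 0 ≤ ℓ k
  map_add : ∀ k l, ℓ (k + l) = ℓ k + ℓ l
  finite : ∀ y, {k | ℓ k ≤ y}.Finite
  count : ∀ y, |({k | ℓ k ≤ y}.ncard : ℝ) - A * rexp y| ≤ C * rexp (θ * y)

namespace BeurlingSystem

variable (S : BeurlingSystem)

theorem one_lt_p' (j : ℕ) : 1 < S.p j := S.one_lt_p.trans_le (S.mono_p (Nat.zero_le j))

theorem one_le_n (k : ℕ →₀ ℕ) : 1 ≤ S.n (S.equiv k) := by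
  rw [S.n_eq]
  exact Finset.one_le_prod fun j _ => one_le_pow₀ (S.one_lt_p' j).le

theorem n_equiv_add (k l : ℕ →₀ ℕ) :
    S.n (S.equiv (k + l)) = S.n (S.equiv k) * S.n (S.equiv l) := by
  simp only [S.n_eq]
  exact Finsupp.prod_add_index' (h := fun j e => S.p j ^ e) (fun j => pow_zero _)
    (fun j a b => pow_add _ _ _)

theorem finite_setOf_n_le (x : ℝ) : {j | S.n j ≤ x}.Finite := by
  obtain ⟨m, hm⟩ := pow_unbounded_of_one_lt x S.one_lt_p
  have hk : S.n (S.equiv (Finsupp.single 0 m)) = S.p 0 ^ m := by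
    rw [S.n_eq]
    exact Finsupp.prod_single_index (h := fun j e => S.p j ^ e) (pow_zero _)
  refine (Set.finite_Iio (S.equiv (Finsupp.single 0 m))).subset fun j hj => ?_
  by_contra hcon
  have h1 := S.mono_n (not_lt.1 hcon)
  rw [hk] at h1
  have : S.n j ≤ x := hj
  linarith

theorem Nint_eq_zero {x : ℝ} (hx : x < 1) : S.Nint x = 0 := by
  unfold Nint
  convert Set.ncard_empty ℕ
  ext j
  simp only [Set.mem_ofPred_eq, Set.mem_empty_iff_false, iff_false, not_le]
  have := S.one_le_n (S.equiv.symm j)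
  rw [Equiv.apply_symm_apply] at this
  linarith

theorem exists_Nint_bound {θ A : ℝ} (hθ0 : 0 ≤ θ) (hθ1 : θ < 1) (hA : 0 < A)
    (hwb : (fun x : ℝ => (S.Nint x : ℝ) - A * x) =O[atTop] fun x : ℝ => x ^ θ) :
    ∃ C, 0 ≤ C ∧ ∀ x : ℝ, 0 < x → |(S.Nint x : ℝ) - A * x| ≤ C * x ^ θ := by
  obtain ⟨c, hc, hb⟩ := hwb.exists_pos
  obtain ⟨x₀, hx₀⟩ := eventually_atTop.1 hb.bound
  refine ⟨c + A + (S.Nint (max x₀ 1) + A * max x₀ 1), by positivity, fun x hx => ?_⟩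
  have hxθ : 0 < x ^ θ := Real.rpow_pos_of_pos hx _
  have hP : 0 ≤ S.Nint (max x₀ 1) + A * max x₀ 1 := by positivity
  rcases lt_or_ge x 1 with h1 | h1
  · rw [S.Nint_eq_zero h1, Nat.cast_zero, zero_sub, abs_neg, abs_of_pos (by positivity)]
    have h2 : x ≤ x ^ θ := by
      calc x = x ^ (1 : ℝ) := (Real.rpow_one x).symm
        _ ≤ x ^ θ := Real.rpow_le_rpow_of_exponent_ge hx h1.le hθ1.le
    nlinarith [mul_le_mul_of_nonneg_left h2 hA.le, mul_nonneg hP hxθ.le, mul_pos hc hxθ]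
  · rcases le_or_gt x₀ x with h2 | h2
    · have h3 := hx₀ x h2
      rw [Real.norm_eq_abs, Real.norm_eq_abs, abs_of_pos hxθ] at h3
      nlinarith [mul_pos hA hxθ, mul_nonneg hP hxθ.le]
    · have h3 : 1 ≤ x ^ θ := Real.one_le_rpow h1 hθ0
      have h4 : (S.Nint x : ℝ) ≤ S.Nint (max x₀ 1) := by
        have : S.Nint x ≤ S.Nint (max x₀ 1) := Set.ncard_le_ncard
          (fun j (hj : S.n j ≤ x) => hj.trans (h2.le.trans (le_max_left _ _)))
          (S.finite_setOf_n_le _)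
        exact_mod_cast this
      have h5 : A * x ≤ A * max x₀ 1 :=
        mul_le_mul_of_nonneg_left (h2.le.trans (le_max_left _ _)) hA.le
      have h6 : |(S.Nint x : ℝ) - A * x| ≤ S.Nint (max x₀ 1) + A * max x₀ 1 := by
        rw [abs_le]
        have : 0 ≤ A * x := by positivity
        have : (0 : ℝ) ≤ S.Nint x := by positivity
        constructor <;> linarith
      nlinarith [mul_pos hA hxθ, mul_pos hc hxθ, mul_le_mul_of_nonneg_left h3 hP]

/-- The logarithm of the generalized integer with exponent vector `k`. -/
noncomputable def logn (k : ℕ →₀ ℕ) : ℝ := Real.log (S.n (S.equiv k))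

theorem setOf_logn_le (y : ℝ) : {k | S.logn k ≤ y} = S.equiv ⁻¹' {j | S.n j ≤ rexp y} := by
  ext k
  simp only [Set.mem_ofPred_eq, Set.mem_preimage, logn]
  exact Real.log_le_iff_le_exp (by linarith [S.one_le_n k])

theorem exists_logSystem {θ A : ℝ} (hθ0 : 0 ≤ θ) (hθ1 : θ < 1) (hA : 0 < A)
    (hwb : (fun x : ℝ => (S.Nint x : ℝ) - A * x) =O[atTop] fun x : ℝ => x ^ θ) :
    ∃ C, LogSystem S.logn θ A C := by
  obtain ⟨C, hC, hb⟩ := S.exists_Nint_bound hθ0 hθ1 hA hwb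
  refine ⟨C, hθ0, hθ1, hA, hC, fun k => Real.log_nonneg (S.one_le_n k), fun k l => ?_,
    fun y => ?_, fun y => ?_⟩
  · simp only [logn]
    rw [S.n_equiv_add, Real.log_mul (by linarith [S.one_le_n k]) (by linarith [S.one_le_n l])]
  · rw [setOf_logn_le]
    exact (S.finite_setOf_n_le _).preimage S.equiv.injective.injOn
  · have h := hb (rexp y) (Real.exp_pos y)
    rw [← Real.exp_mul, mul_comm y θ] at h
    rw [setOf_logn_le, Set.ncard_preimage_of_injective_subset_range S.equiv.injective]
    · exact h
    · simp [S.equiv.surjective.range_eq]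

theorem tsum_n_eq (s : ℂ) :
    ∑' j : ℕ, (S.n j : ℂ) ^ (-s) = ∑' k, cexp (-s * S.logn k) := by
  rw [← S.equiv.tsum_eq]
  congr 1
  ext k
  have h : 0 < S.n (S.equiv k) := by linarith [S.one_le_n k]
  rw [Complex.cpow_def_of_ne_zero (by exact_mod_cast h.ne'), logn, Complex.ofReal_log h.le, mul_comm]

end BeurlingSystem

end LogSystems

namespace LogSystem

open MeasureTheory Complex Real

/-- The counting function of the logarithms. -/
noncomputable def cnt (ℓ : (ℕ →₀ ℕ) → ℝ) (y : ℝ) : ℝ := ({k | ℓ k ≤ y}.ncard : ℝ)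

/-- The remainder term of the counting function. -/
noncomputable def err (ℓ : (ℕ →₀ ℕ) → ℝ) (A y : ℝ) : ℝ := cnt ℓ y - A * rexp y

/-- The Laplace transform of the remainder term. -/
noncomputable def lap (ℓ : (ℕ →₀ ℕ) → ℝ) (A : ℝ) (s : ℂ) : ℂ :=
  ∫ y in Set.Ioi (0 : ℝ), (err ℓ A y : ℂ) * cexp (-s * y)

theorem integral_exp_Ioi {σ : ℝ} (hσ : 0 < σ) (a : ℝ) :
    ∫ y in Set.Ioi a, rexp (-σ * y) = rexp (-σ * a) / σ := by
  rw [integral_exp_mul_Ioi (by linarith) a]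
  field_simp

theorem integrableOn_exp_Ioi {σ : ℝ} (hσ : 0 < σ) (a : ℝ) :
    IntegrableOn (fun y => rexp (-σ * y)) (Set.Ioi a) :=
  integrableOn_exp_mul_Ioi (by linarith) a

theorem norm_cexp_mul (s : ℂ) (y : ℝ) : ‖cexp (-s * y)‖ = rexp (-s.re * y) := by
  rw [Complex.norm_exp]; simp

theorem integral_cexp_Ioi {s : ℂ} (hs : 0 < s.re) (a : ℝ) :
    ∫ y in Set.Ioi a, cexp (-s * y) = cexp (-s * a) / s := by
  have : s ≠ 0 := by rintro rfl; simp at hs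
  rw [integral_exp_mul_complex_Ioi (by simpa using hs) a]
  field_simp

theorem integrableOn_cexp_Ioi {s : ℂ} (hs : 0 < s.re) (a : ℝ) :
    IntegrableOn (fun y : ℝ => cexp (-s * y)) (Set.Ioi a) :=
  integrableOn_exp_mul_complex_Ioi (by simpa using hs) a

theorem integral_indicator_exp {σ : ℝ} (hσ : 0 < σ) {a : ℝ} (ha : 0 ≤ a) :
    ∫ y in Set.Ioi (0 : ℝ), (Set.Ici a).indicator (fun y => rexp (-σ * y)) y
      = rexp (-σ * a) / σ := by
  rw [setIntegral_indicator measurableSet_Ici]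
  have : (Set.Ioi (0 : ℝ) ∩ Set.Ici a : Set ℝ) =ᵐ[volume] Set.Ioi a := by
    have h1 : (Set.Ioi (0 : ℝ) ∩ Set.Ici a : Set ℝ) =ᵐ[volume] (Set.Ioi (0 : ℝ) ∩ Set.Ioi a : Set ℝ) :=
      (ae_eq_refl _).inter Ioi_ae_eq_Ici.symm
    rwa [Set.Ioi_inter_Ioi, max_eq_right ha] at h1
  rw [setIntegral_congr_set this, integral_exp_Ioi hσ]

variable {ℓ : (ℕ →₀ ℕ) → ℝ} {θ A C : ℝ} (H : LogSystem ℓ θ A C)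
include H

theorem cnt_mono : Monotone (cnt ℓ) := fun x y hxy => by
  have := Set.ncard_le_ncard
    (show {k | ℓ k ≤ x} ⊆ {k | ℓ k ≤ y} from fun k (hk : ℓ k ≤ x) => hk.trans hxy) (H.finite y)
  unfold cnt
  exact_mod_cast this

theorem measurable_err : Measurable (err ℓ A) := by
  have := H.cnt_mono.measurable
  unfold err
  fun_prop

theorem abs_err_le (y : ℝ) : |err ℓ A y| ≤ C * rexp (θ * y) := H.count y

theorem cnt_le {y : ℝ} (hy : 0 ≤ y) : cnt ℓ y ≤ (A + C) * rexp y := by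
  have h1 := (abs_le.1 (H.abs_err_le y)).2
  have h2 : rexp (θ * y) ≤ rexp y := by
    apply Real.exp_le_exp.2
    nlinarith [H.theta_lt_one]
  unfold err at h1
  nlinarith [mul_le_mul_of_nonneg_left h2 H.C_nonneg]

theorem sum_indicator_le (F : Finset (ℕ →₀ ℕ)) (y : ℝ) :
    ∑ k ∈ F, (Set.Ici (ℓ k)).indicator (fun _ => (1 : ℝ)) y ≤ cnt ℓ y := by
  classical
  have : ∀ k, (Set.Ici (ℓ k)).indicator (fun _ => (1 : ℝ)) y = if ℓ k ≤ y then 1 else 0 := by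
    intro k; simp [Set.indicator_apply]
  simp only [this, Finset.sum_boole]
  have h : (F.filter fun k => ℓ k ≤ y).card ≤ {k | ℓ k ≤ y}.ncard := by
    rw [← Set.ncard_coe_finset]
    refine Set.ncard_le_ncard (fun k hk => ?_) (H.finite y)
    simp at hk
    exact hk.2
  unfold cnt
  exact_mod_cast h

theorem sum_exp_le {σ : ℝ} (hσ : 1 < σ) (F : Finset (ℕ →₀ ℕ)) :
    ∑ k ∈ F, rexp (-σ * ℓ k) ≤ (A + C) * σ / (σ - 1) := by
  have h0 : 0 < σ := by linarith
  have hi : ∀ k, IntegrableOn ((Set.Ici (ℓ k)).indicator fun y => rexp (-σ * y)) (Set.Ioi 0) :=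
    fun k => (integrableOn_exp_Ioi h0 0).indicator measurableSet_Ici
  have h1 : ∑ k ∈ F, rexp (-σ * ℓ k) = σ * ∫ y in Set.Ioi (0 : ℝ),
      ∑ k ∈ F, (Set.Ici (ℓ k)).indicator (fun y => rexp (-σ * y)) y := by
    rw [integral_finsetSum _ fun k _ => hi k]
    simp_rw [integral_indicator_exp h0 (H.nonneg _)]
    rw [Finset.mul_sum]
    refine Finset.sum_congr rfl fun k _ => ?_
    field_simp
  have h2 : ∫ y in Set.Ioi (0 : ℝ),
      ∑ k ∈ F, (Set.Ici (ℓ k)).indicator (fun y => rexp (-σ * y)) y ≤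
      ∫ y in Set.Ioi (0 : ℝ), (A + C) * rexp (-(σ - 1) * y) := by
    refine setIntegral_mono_on (integrable_finsetSum _ fun k _ => hi k)
      ((integrableOn_exp_Ioi (by linarith) 0).const_mul _) measurableSet_Ioi ?_
    intro y hy
    have h3 : ∑ k ∈ F, (Set.Ici (ℓ k)).indicator (fun y => rexp (-σ * y)) y =
        (∑ k ∈ F, (Set.Ici (ℓ k)).indicator (fun _ => (1 : ℝ)) y) * rexp (-σ * y) := by
      rw [Finset.sum_mul]
      refine Finset.sum_congr rfl fun k _ => ?_
      simp only [Set.indicator_apply]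
      split_ifs <;> simp
    rw [h3]
    calc _ ≤ (A + C) * rexp y * rexp (-σ * y) := by
          gcongr
          exact (H.sum_indicator_le F y).trans (H.cnt_le (le_of_lt hy))
      _ = _ := by
          rw [mul_assoc, ← Real.exp_add]
          congr 2
          ring
  rw [h1]
  rw [integral_const_mul, integral_exp_Ioi (by linarith)] at h2
  calc _ ≤ σ * ((A + C) * (rexp (-(σ - 1) * 0) / (σ - 1))) := by gcongr
    _ = _ := by simp; field_simp

theorem summable_exp {σ : ℝ} (hσ : 1 < σ) : Summable fun k => rexp (-σ * ℓ k) :=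
  summable_of_sum_le (fun _ => (Real.exp_pos _).le) (fun F => H.sum_exp_le hσ F)

theorem tsum_exp_le {σ : ℝ} (hσ : 1 < σ) : ∑' k, rexp (-σ * ℓ k) ≤ (A + C) * σ / (σ - 1) :=
  (H.summable_exp hσ).tsum_le_of_sum_le fun F => H.sum_exp_le hσ F

theorem hasSum_indicator (s : ℂ) (y : ℝ) :
    HasSum (fun k => (Set.Ici (ℓ k)).indicator (fun y : ℝ => cexp (-s * y)) y)
      ((cnt ℓ y : ℂ) * cexp (-s * y)) := by
  classical
  have h : HasSum (fun k => (Set.Ici (ℓ k)).indicator (fun y : ℝ => cexp (-s * y)) y)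
      (∑ k ∈ (H.finite y).toFinset, (Set.Ici (ℓ k)).indicator (fun y : ℝ => cexp (-s * y)) y) := by
    apply hasSum_sum_of_ne_finset_zero
    intro k hk
    have hk' : ¬ ℓ k ≤ y := by simpa using hk
    simp [hk']
  convert h using 1
  rw [Finset.sum_congr rfl (g := fun _ => cexp (-s * y))]
  · rw [Finset.sum_const, nsmul_eq_mul]
    unfold cnt
    rw [Set.ncard_eq_toFinset_card _ (H.finite y)]
    simp
  · intro k hk
    have hk' : ℓ k ≤ y := by simpa using hk
    simp [hk']

theorem tsum_cexp_eq {s : ℂ} (hs : 1 < s.re) :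
    ∑' k, cexp (-s * ℓ k) = s * ∫ y in Set.Ioi (0 : ℝ), (cnt ℓ y : ℂ) * cexp (-s * y) := by
  have h0 : 0 < s.re := by linarith
  have hs0 : s ≠ 0 := by rintro rfl; simp at h0
  have hi : ∀ k, IntegrableOn ((Set.Ici (ℓ k)).indicator fun y : ℝ => cexp (-s * y)) (Set.Ioi 0) :=
    fun k => (integrableOn_cexp_Ioi h0 0).indicator measurableSet_Ici
  have hn : ∀ k, ∫ y in Set.Ioi (0 : ℝ), ‖(Set.Ici (ℓ k)).indicator (fun y : ℝ => cexp (-s * y)) y‖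
      = rexp (-s.re * ℓ k) / s.re := by
    intro k
    rw [← integral_indicator_exp h0 (H.nonneg k)]
    congr 1
    ext y
    rw [norm_indicator_eq_indicator_norm]
    simp only [Set.indicator_apply, norm_cexp_mul]
  have hv : ∀ k, ∫ y in Set.Ioi (0 : ℝ), (Set.Ici (ℓ k)).indicator (fun y : ℝ => cexp (-s * y)) y
      = cexp (-s * ℓ k) / s := by
    intro k
    rw [setIntegral_indicator measurableSet_Ici, ← integral_cexp_Ioi h0]
    apply setIntegral_congr_set
    have h1 : (Set.Ioi (0 : ℝ) ∩ Set.Ici (ℓ k) : Set ℝ) =ᵐ[volume]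
        (Set.Ioi (0 : ℝ) ∩ Set.Ioi (ℓ k) : Set ℝ) := (ae_eq_refl _).inter Ioi_ae_eq_Ici.symm
    rwa [Set.Ioi_inter_Ioi, max_eq_right (H.nonneg k)] at h1
  have h := hasSum_integral_of_summable_integral_norm hi
    (by simp_rw [hn]; exact (H.summable_exp hs).div_const _)
  simp_rw [hv, (H.hasSum_indicator s _).tsum_eq] at h
  rw [← h.tsum_eq, tsum_div_const]
  field_simp

theorem norm_err_mul_cexp_le (s : ℂ) (y : ℝ) :
    ‖(err ℓ A y : ℂ) * cexp (-s * y)‖ ≤ C * rexp (-(s.re - θ) * y) := by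
  rw [norm_mul, norm_cexp_mul, Complex.norm_real, Real.norm_eq_abs]
  calc _ ≤ C * rexp (θ * y) * rexp (-s.re * y) := by gcongr; exact H.abs_err_le y
    _ = _ := by rw [mul_assoc, ← Real.exp_add]; congr 2; ring

theorem aestronglyMeasurable_err_mul_cexp (s : ℂ) (μ : Measure ℝ) :
    AEStronglyMeasurable (fun y : ℝ => (err ℓ A y : ℂ) * cexp (-s * y)) μ := by
  have := H.measurable_err
  exact Measurable.aestronglyMeasurable (by fun_prop)

theorem integrableOn_err_mul_cexp {s : ℂ} (hs : θ < s.re) (a : ℝ) :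
    IntegrableOn (fun y : ℝ => (err ℓ A y : ℂ) * cexp (-s * y)) (Set.Ioi a) :=
  ((integrableOn_exp_Ioi (sub_pos.2 hs) a).const_mul C).mono'
    (H.aestronglyMeasurable_err_mul_cexp s _)
    (Eventually.of_forall fun y => H.norm_err_mul_cexp_le s y)

theorem norm_lap_le {s : ℂ} (hs : θ < s.re) : ‖lap ℓ A s‖ ≤ C / (s.re - θ) := by
  unfold lap
  refine (norm_integral_le_of_norm_le
    ((integrableOn_exp_Ioi (sub_pos.2 hs) 0).const_mul C)
    (Eventually.of_forall fun y => H.norm_err_mul_cexp_le s y)).trans_eq ?_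
  rw [integral_const_mul, integral_exp_Ioi (sub_pos.2 hs)]
  simp [div_eq_mul_inv]

theorem tsum_cexp_eq_lap {s : ℂ} (hs : 1 < s.re) :
    ∑' k, cexp (-s * ℓ k) = A * s / (s - 1) + s * lap ℓ A s := by
  have h0 : s - 1 ≠ 0 := fun h => by
    have : s = 1 := sub_eq_zero.1 h
    rw [this] at hs; simp at hs
  have hre : 0 < (s - 1).re := by simpa using hs
  rw [H.tsum_cexp_eq hs]
  have h1 := integrableOn_err_mul_cexp H (H.theta_lt_one.trans hs) 0
  have h2 := (integrableOn_cexp_Ioi hre 0).const_mul (A : ℂ)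
  have h3 : ∀ y : ℝ, (cnt ℓ y : ℂ) * cexp (-s * y) =
      (err ℓ A y : ℂ) * cexp (-s * y) + A * cexp (-(s - 1) * y) := by
    intro y
    have : cexp (-(s - 1) * y) = cexp y * cexp (-s * y) := by
      rw [← Complex.exp_add]; congr 1; ring
    rw [this]
    unfold err
    push_cast
    ring
  simp_rw [h3]
  rw [integral_add h1 h2, integral_const_mul, integral_cexp_Ioi hre]
  unfold lap
  simp
  field_simp
  ring

theorem differentiableAt_lap {s : ℂ} (hs : θ < s.re) : DifferentiableAt ℂ (lap ℓ A) s := by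
  set ε := (s.re - θ) / 2 with hε
  have hε0 : 0 < ε := by simp only [hε]; linarith
  have := hasDerivAt_integral_of_dominated_loc_of_deriv_le
    (μ := volume.restrict (Set.Ioi (0 : ℝ)))
    (F := fun s (y : ℝ) => (err ℓ A y : ℂ) * cexp (-s * y))
    (F' := fun s (y : ℝ) => (err ℓ A y : ℂ) * cexp (-s * y) * -y) (x₀ := s)
    (bound := fun y => (2 / ε) * (C * rexp (-(ε / 2) * y))) (Metric.ball_mem_nhds s hε0) ?_ ?_ ?_ ?_ ?_ ?_
  · exact this.2.differentiableAt
  · exact Eventually.of_forall fun s => H.aestronglyMeasurable_err_mul_cexp s _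
  · exact H.integrableOn_err_mul_cexp hs 0
  · exact (H.aestronglyMeasurable_err_mul_cexp s _).mul
      (by fun_prop : Continuous _).aestronglyMeasurable
  · refine (ae_restrict_iff' measurableSet_Ioi).2 (Eventually.of_forall fun y hy z hz => ?_)
    have hy0 : 0 < y := hy
    have hz1 : θ + ε < z.re := by
      have h1 := (Complex.abs_re_le_norm (z - s)).trans_lt (mem_ball_iff_norm.1 hz)
      have h2 := (abs_lt.1 h1).1
      simp only [sub_re] at h2
      simp only [hε] at h2 ⊢
      linarith
    rw [norm_mul, norm_neg, Complex.norm_real, Real.norm_eq_abs, abs_of_pos hy0]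
    calc _ ≤ C * rexp (-(z.re - θ) * y) * y := by
          gcongr; exact H.norm_err_mul_cexp_le z y
      _ ≤ C * rexp (-ε * y) * ((2 / ε) * rexp (ε / 2 * y)) := by
          have := H.C_nonneg
          gcongr
          · linarith
          · have := Real.add_one_le_exp (ε / 2 * y)
            calc y = (2 / ε) * (ε / 2 * y) := by field_simp
              _ ≤ _ := by gcongr; linarith
      _ = _ := by
          rw [show -ε * y = -(ε / 2) * y + -(ε / 2 * y) by ring, Real.exp_add, Real.exp_neg (ε / 2 * y)]
          field_simp
  · exact ((integrableOn_exp_Ioi (by positivity) 0).const_mul C).const_mul _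
  · refine Eventually.of_forall fun y z _ => ?_
    have h1 : HasDerivAt (fun z : ℂ => -z * y) (-(y : ℂ)) z := by
      simpa using ((hasDerivAt_id z).neg).mul_const (y : ℂ)
    have := (h1.cexp).const_mul (err ℓ A y : ℂ)
    rw [← mul_assoc] at this
    exact this

end LogSystem

namespace LogSystem

open MeasureTheory Complex Real

variable {ℓ : (ℕ →₀ ℕ) → ℝ} {θ A C : ℝ} (H : LogSystem ℓ θ A C)

theorem integral_cexp_translate (t a h : ℝ) :
    ∫ y in a..a + h, cexp (-(t * y) * I) =
      cexp (-(t * a) * I) * ∫ y in (0 : ℝ)..h, cexp (-(t * y) * I) := by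
  have := intervalIntegral.integral_comp_add_left (a := 0) (b := h)
    (fun y : ℝ => cexp (-(t * y) * I)) a
  rw [add_zero] at this
  rw [← this, ← intervalIntegral.integral_const_mul]
  congr 1
  ext y
  rw [← Complex.exp_add]
  push_cast
  congr 1
  ring

theorem half_le_norm_integral_cexp {t h : ℝ} (hh : 0 ≤ h) (ht : |t| * h ≤ 1) :
    h / 2 ≤ ‖∫ y in (0 : ℝ)..h, cexp (-(t * y) * I)‖ := by
  refine le_trans ?_ (Complex.re_le_norm _)
  have hi : IntervalIntegrable (fun y : ℝ => cexp (-(t * y) * I)) volume 0 h :=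
    (by fun_prop : Continuous fun y : ℝ => cexp (-(t * y) * I)).intervalIntegrable _ _
  have h1 : (∫ y in (0 : ℝ)..h, cexp (-(t * y) * I)).re =
      ∫ y in (0 : ℝ)..h, (cexp (-(t * y) * I)).re :=
    (intervalIntegral.intervalIntegral_re hi).symm
  rw [h1]
  have h2 : h / 2 = ∫ y in (0 : ℝ)..h, (1 / 2 : ℝ) := by simp; ring
  rw [h2]
  apply intervalIntegral.integral_mono_on hh (by simp)
  · exact (by fun_prop : Continuous fun y : ℝ => (cexp (-(t * y) * I)).re).intervalIntegrable _ _
  · intro y hy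
    have h3 : (cexp (-(t * y) * I)).re = Real.cos (t * y) := by
      rw [show -((t : ℂ) * y) * I = ((-(t * y) : ℝ) : ℂ) * I by push_cast; ring,
        Complex.exp_ofReal_mul_I_re, Real.cos_neg]
    rw [h3]
    have h4 : |t * y| ≤ 1 := by
      rw [abs_mul, abs_of_nonneg hy.1]
      exact (mul_le_mul_of_nonneg_left hy.2 (abs_nonneg t)).trans ht
    have h5 : (t * y) ^ 2 ≤ 1 := (sq_le_one_iff_abs_le_one _).2 h4
    linarith [Real.one_sub_sq_div_two_le_cos (x := t * y)]

include H

theorem sum_indicator_Ico_le (F : Finset (ℕ →₀ ℕ)) {h : ℝ} (hh : 0 ≤ h) (y : ℝ) :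
    ∑ k ∈ F, (Set.Ico (ℓ k) (ℓ k + h)).indicator (fun _ => (1 : ℝ)) y
      ≤ A * h * rexp y + 2 * C * rexp (θ * y) := by
  classical
  have h0 : ∀ k, (Set.Ico (ℓ k) (ℓ k + h)).indicator (fun _ => (1 : ℝ)) y
      = if ℓ k ≤ y ∧ y < ℓ k + h then 1 else 0 := by
    intro k; simp [Set.indicator_apply]
  simp only [h0, Finset.sum_boole]
  have h1 : (F.filter fun k => ℓ k ≤ y ∧ y < ℓ k + h).card ≤
      ({k | ℓ k ≤ y} \ {k | ℓ k ≤ y - h}).ncard := by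
    rw [← Set.ncard_coe_finset]
    refine Set.ncard_le_ncard (fun k hk => ?_) (H.finite y).sdiff
    simp only [Finset.coe_filter, Set.mem_ofPred_eq] at hk
    refine ⟨hk.2.1, fun h' => ?_⟩
    have h'' : ℓ k ≤ y - h := h'
    linarith [hk.2.2]
  have h2 := Set.ncard_sdiff_add_ncard_of_subset
    (show {k | ℓ k ≤ y - h} ⊆ {k | ℓ k ≤ y} from fun k (hk : ℓ k ≤ y - h) => by
      show ℓ k ≤ y; linarith) (H.finite y)
  have h3 : ((F.filter fun k => ℓ k ≤ y ∧ y < ℓ k + h).card : ℝ) ≤ cnt ℓ y - cnt ℓ (y - h) := by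
    unfold cnt
    rw [← h2]
    push_cast
    rw [add_sub_cancel_right]
    exact_mod_cast h1
  refine h3.trans ?_
  have h4 := (abs_le.1 (H.abs_err_le y)).2
  have h5 := (abs_le.1 (H.abs_err_le (y - h))).1
  have h6 : rexp (θ * (y - h)) ≤ rexp (θ * y) :=
    Real.exp_le_exp.2 (mul_le_mul_of_nonneg_left (by linarith) H.theta_nonneg)
  have h7 : rexp y * (1 - h) ≤ rexp (y - h) := by
    rw [sub_eq_add_neg y h, Real.exp_add]
    gcongr
    linarith [Real.add_one_le_exp (-h)]
  unfold err at h4 h5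
  nlinarith [mul_le_mul_of_nonneg_left h6 H.C_nonneg, mul_le_mul_of_nonneg_left h7 H.A_pos.le]

/-- The mean value theorem for finite generalized Dirichlet polynomials. -/
theorem mean_value (F : Finset (ℕ →₀ ℕ)) (a : (ℕ →₀ ℕ) → ℂ) {T : ℝ} (hT : 1 ≤ T) :
    ∫ t in -T..T, ‖∑ k ∈ F, a k * cexp (-(t * ℓ k) * I)‖ ^ 2 ≤
      8 * π * rexp 2 * (A + 2 * C) * ∑ k ∈ F, ‖a k‖ ^ 2 * (rexp (ℓ k) + T * rexp (θ * ℓ k)) := by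
  classical
  have hT0 : 0 < T := by linarith
  set h : ℝ := 1 / T with hh
  have hh0 : 0 < h := by positivity
  have hh1 : h ≤ 1 := by rw [hh, div_le_one hT0]; exact hT
  set u : (ℕ →₀ ℕ) → ℝ → ℝ := fun k => (Set.Ico (ℓ k) (ℓ k + h)).indicator (fun _ => (1 : ℝ)) with hu
  have hu0 : ∀ k y, 0 ≤ u k y := fun k y => Set.indicator_nonneg (fun _ _ => zero_le_one) _
  have husq : ∀ k y, u k y ^ 2 = u k y := by
    intro k y; simp only [hu, Set.indicator_apply]; split_ifs <;> simp
  have hui : ∀ k, Integrable (u k) := fun k =>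
    (integrable_indicator_iff measurableSet_Ico).2 (integrableOn_const (by simp))
  have huI : ∀ k, ∫ y, u k y = h := by
    intro k
    rw [hu]
    simp only
    rw [integral_indicator measurableSet_Ico]
    simp [hh0.le]
  set g : ℝ → ℂ := fun y => ∑ k ∈ F, a k * (u k y : ℂ) with hg
  have hgm : Measurable g := by
    have : ∀ k, Measurable (u k) := fun k => measurable_const.indicator measurableSet_Ico
    simp only [hg]
    fun_prop
  have hgi : Integrable g := integrable_finsetSum _ fun k _ => ((hui k).ofReal).const_mul _
  have hgb : ∀ y, ‖g y‖ ^ 2 ≤ ∑ k ∈ F, ‖a k‖ ^ 2 *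
      (rexp 1 * (A + 2 * C) * (h * rexp (ℓ k) + rexp (θ * ℓ k))) * u k y := by
    intro y
    have h1 : ‖g y‖ ≤ ∑ k ∈ F, (‖a k‖ * u k y) * u k y := by
      refine (norm_sum_le _ _).trans (Finset.sum_le_sum fun k _ => ?_)
      rw [norm_mul, Complex.norm_real, Real.norm_eq_abs, abs_of_nonneg (hu0 k y), mul_assoc,
        ← sq, husq]
    have h2 : ‖g y‖ ^ 2 ≤ (∑ k ∈ F, (‖a k‖ * u k y) ^ 2) * ∑ k ∈ F, u k y ^ 2 :=
      (pow_le_pow_left₀ (norm_nonneg _) h1 2).trans (Finset.sum_mul_sq_le_sq_mul_sq _ _ _)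
    refine h2.trans ?_
    rw [Finset.sum_mul]
    refine Finset.sum_le_sum fun k _ => ?_
    simp_rw [husq]
    rw [mul_pow, husq, mul_assoc, mul_assoc]
    refine mul_le_mul_of_nonneg_left ?_ (sq_nonneg _)
    by_cases hy : y ∈ Set.Ico (ℓ k) (ℓ k + h)
    · have h3 : u k y = 1 := by simp only [hu]; rw [Set.indicator_of_mem hy]
      rw [h3, one_mul, mul_one]
      refine (H.sum_indicator_Ico_le F hh0.le y).trans ?_
      have h4 : rexp y ≤ rexp 1 * rexp (ℓ k) := by
        rw [← Real.exp_add]; exact Real.exp_le_exp.2 (by linarith [hy.2])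
      have h5 : rexp (θ * y) ≤ rexp 1 * rexp (θ * ℓ k) := by
        rw [← Real.exp_add]
        apply Real.exp_le_exp.2
        nlinarith [hy.2, H.theta_lt_one, H.theta_nonneg]
      have hA := H.A_pos
      have hC := H.C_nonneg
      calc _ ≤ A * h * (rexp 1 * rexp (ℓ k)) + 2 * C * (rexp 1 * rexp (θ * ℓ k)) := by gcongr
        _ ≤ _ := by
          have e1 := Real.exp_pos 1
          have e2 := Real.exp_pos (ℓ k)
          have e3 := Real.exp_pos (θ * ℓ k)
          have p1 : 0 ≤ rexp 1 * (A * rexp (θ * ℓ k)) := by positivity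
          have p2 : 0 ≤ rexp 1 * (2 * C * (h * rexp (ℓ k))) := by positivity
          linarith
    · have h3 : u k y = 0 := by simp only [hu]; rw [Set.indicator_of_notMem hy]
      simp [h3]
  have hri : Integrable fun y => ∑ k ∈ F, ‖a k‖ ^ 2 *
      (rexp 1 * (A + 2 * C) * (h * rexp (ℓ k) + rexp (θ * ℓ k))) * u k y :=
    integrable_finsetSum _ fun k _ => (hui k).const_mul _
  have hg2 : Integrable fun y => ‖g y‖ ^ 2 :=
    hri.mono' (hgm.norm.pow_const 2).aestronglyMeasurable
      (Eventually.of_forall fun y => by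
        rw [Real.norm_eq_abs, abs_of_nonneg (sq_nonneg _)]; exact hgb y)
  have hgI : ∫ y, ‖g y‖ ^ 2 ≤ ∑ k ∈ F, ‖a k‖ ^ 2 *
      (rexp 1 * (A + 2 * C) * (h * rexp (ℓ k) + rexp (θ * ℓ k))) * h := by
    refine (integral_mono hg2 hri hgb).trans_eq ?_
    rw [integral_finsetSum _ fun k _ => (hui k).const_mul _]
    refine Finset.sum_congr rfl fun k _ => ?_
    rw [integral_const_mul, huI]
  have hF : ∀ t : ℝ, ∫ y, g y * cexp (-(t * y) * I) =
      (∑ k ∈ F, a k * cexp (-(t * ℓ k) * I)) * ∫ y in (0 : ℝ)..h, cexp (-(t * y) * I) := by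
    intro t
    have hui' : ∀ k, ∀ y : ℝ, (u k y : ℂ) * cexp (-(t * y) * I) =
        (Set.Ico (ℓ k) (ℓ k + h)).indicator (fun y : ℝ => cexp (-(t * y) * I)) y := by
      intro k y
      simp only [hu, Set.indicator_apply]
      split_ifs <;> simp
    have hi : ∀ k, Integrable
        ((Set.Ico (ℓ k) (ℓ k + h)).indicator (fun y : ℝ => cexp (-(t * y) * I))) := fun k =>
      (integrable_indicator_iff measurableSet_Ico).2
        (((by fun_prop : Continuous fun y : ℝ => cexp (-(t * y) * I)).continuousOn.integrableOn_Icc).mono_set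
          Set.Ico_subset_Icc_self)
    simp only [hg]
    simp_rw [Finset.sum_mul, mul_assoc, hui']
    rw [integral_finsetSum _ fun k _ => (hi k).const_mul _]
    refine Finset.sum_congr rfl fun k _ => ?_
    rw [integral_const_mul, integral_indicator measurableSet_Ico, integral_Ico_eq_integral_Ioc,
      ← intervalIntegral.integral_of_le (by linarith), integral_cexp_translate]
  have hpt : ∀ t ∈ Set.Icc (-T) T, ‖∑ k ∈ F, a k * cexp (-(t * ℓ k) * I)‖ ^ 2 ≤
      4 * T ^ 2 * ‖∫ y, g y * cexp (-(t * y) * I)‖ ^ 2 := by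
    intro t ht
    rw [hF, norm_mul, mul_pow]
    have h1 : |t| * h ≤ 1 := by
      rw [hh, mul_one_div, div_le_one hT0]; exact abs_le.2 ht
    have h2 := half_le_norm_integral_cexp hh0.le h1
    have h3 : 1 ≤ 4 * T ^ 2 * ‖∫ y in (0 : ℝ)..h, cexp (-(t * y) * I)‖ ^ 2 := by
      calc (1 : ℝ) = 4 * T ^ 2 * (h / 2) ^ 2 := by rw [hh]; field_simp; norm_num
        _ ≤ _ := by gcongr
    nlinarith [sq_nonneg ‖∑ k ∈ F, a k * cexp (-(t * ℓ k) * I)‖]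
  have hint : ∫ t in -T..T, ‖∑ k ∈ F, a k * cexp (-(t * ℓ k) * I)‖ ^ 2 ≤
      ∫ t in -T..T, 4 * T ^ 2 * ‖∫ y, g y * cexp (-(t * y) * I)‖ ^ 2 := by
    have hcont := continuous_fourier_integral hgi
    refine intervalIntegral.integral_mono_on (by linarith)
      (Continuous.intervalIntegrable (by fun_prop) _ _)
      (Continuous.intervalIntegrable (by fun_prop) _ _) hpt
  rw [intervalIntegral.integral_const_mul] at hint
  refine hint.trans ?_
  calc _ ≤ 4 * T ^ 2 * (2 * π * rexp 1 * (∑ k ∈ F, ‖a k‖ ^ 2 *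
      (rexp 1 * (A + 2 * C) * (h * rexp (ℓ k) + rexp (θ * ℓ k))) * h)) := by
        gcongr
        exact (integral_norm_sq_fourier_le hgi hg2 hT0).trans (by gcongr)
    _ = _ := by
        rw [show rexp 2 = rexp 1 * rexp 1 by rw [← Real.exp_add]; norm_num]
        simp only [Finset.mul_sum]
        refine Finset.sum_congr rfl fun k _ => ?_
        rw [hh]
        field_simp
        ring

/-- The mean value theorem for absolutely convergent generalized Dirichlet series. -/
theorem mean_value_tsum (a : (ℕ →₀ ℕ) → ℂ) (ha : Summable fun k => ‖a k‖) {T B : ℝ} (hT : 1 ≤ T)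
    (hB : ∀ F : Finset (ℕ →₀ ℕ), ∑ k ∈ F, ‖a k‖ ^ 2 * (rexp (ℓ k) + T * rexp (θ * ℓ k)) ≤ B) :
    ∫ t in -T..T, ‖∑' k, a k * cexp (-(t * ℓ k) * I)‖ ^ 2 ≤
      8 * π * rexp 2 * (A + 2 * C) * B := by
  have hA := H.A_pos
  have hC := H.C_nonneg
  have hn : ∀ k (t : ℝ), ‖a k * cexp (-(t * ℓ k) * I)‖ = ‖a k‖ := by
    intro k t
    rw [norm_mul, show -((t : ℂ) * ℓ k) * I = ((-(t * ℓ k) : ℝ) : ℂ) * I by push_cast; ring,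
      Complex.norm_exp_ofReal_mul_I, mul_one]
  have hlim : Tendsto (fun F : Finset (ℕ →₀ ℕ) =>
      ∫ t in -T..T, ‖∑ k ∈ F, a k * cexp (-(t * ℓ k) * I)‖ ^ 2) atTop
      (nhds (∫ t in -T..T, ‖∑' k, a k * cexp (-(t * ℓ k) * I)‖ ^ 2)) := by
    refine intervalIntegral.tendsto_integral_filter_of_dominated_convergence
      (fun _ => (∑' k, ‖a k‖) ^ 2) ?_ ?_ ?_ ?_
    · exact Eventually.of_forall fun F => Continuous.aestronglyMeasurable (by fun_prop)
    · refine Eventually.of_forall fun F => Eventually.of_forall fun t _ => ?_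
      rw [Real.norm_eq_abs, abs_of_nonneg (sq_nonneg _)]
      gcongr
      refine (norm_sum_le _ _).trans ?_
      simp_rw [hn]
      exact ha.sum_le_tsum _ fun _ _ => norm_nonneg _
    · simp
    · refine Eventually.of_forall fun t _ => ?_
      have : Summable fun k => a k * cexp (-(t * ℓ k) * I) := by
        apply Summable.of_norm
        simpa only [hn] using ha
      exact (this.hasSum.norm).pow 2
  refine le_of_tendsto hlim (Eventually.of_forall fun F => (H.mean_value F a hT).trans ?_)
  gcongr
  exact hB F

end LogSystem

section Antidiagonal

open Finset.HasAntidiagonal (antidiagonal mem_antidiagonal)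

theorem hasSum_antidiagonal_mul_char {𝕜 : Type*} [RCLike 𝕜]
    {E : (ℕ →₀ ℕ) → 𝕜} (hE : ∀ k l, E (k + l) = E k * E l) {a b : (ℕ →₀ ℕ) → 𝕜}
    (ha : Summable fun k => ‖a k * E k‖) (hb : Summable fun k => ‖b k * E k‖) :
    HasSum (fun k => (∑ p ∈ antidiagonal k, a p.1 * b p.2) * E k)
      ((∑' k, a k * E k) * ∑' k, b k * E k) := by
  have hm := summable_mul_of_summable_norm ha hb
  have h1 := ha.of_norm.tsum_mul_tsum_eq_tsum_sum_antidiagonal hb.of_norm hm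
  have h2 := summable_sum_mul_antidiagonal_of_summable_mul
    (f := fun k => a k * E k) (g := fun k => b k * E k) hm
  have h3 : (fun k => ∑ p ∈ antidiagonal k, a p.1 * E p.1 * (b p.2 * E p.2)) = fun k =>
      (∑ p ∈ antidiagonal k, a p.1 * b p.2) * E k := by
    funext k
    rw [Finset.sum_mul]
    refine Finset.sum_congr rfl fun p hp => ?_
    rw [← mem_antidiagonal.1 hp, hE]
    ring
  rw [h3] at h1 h2
  rw [h1]
  exact h2.hasSum

/-- The Möbius function on exponent vectors. -/
noncomputable def expMoebius (k : ℕ →₀ ℕ) : ℂ :=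
  open Classical in if ∀ j, k j ≤ 1 then (-1) ^ k.degree else 0

theorem norm_expMoebius_le (k : ℕ →₀ ℕ) : ‖expMoebius k‖ ≤ 1 := by
  unfold expMoebius
  split_ifs <;> simp

theorem expMoebius_zero : expMoebius 0 = 1 := by simp [expMoebius]

theorem expMoebius_add_single {k : ℕ →₀ ℕ} {j : ℕ} (hk : k j = 0) :
    expMoebius (k + Finsupp.single j 1) = - expMoebius k := by
  have h1 : (∀ i, (k + Finsupp.single j 1 : ℕ →₀ ℕ) i ≤ 1) ↔ ∀ i, k i ≤ 1 := by
    constructor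
    · intro h i
      have := h i
      simp only [Finsupp.add_apply] at this
      omega
    · intro h i
      have := h i
      by_cases hij : j = i
      · subst hij; simp [hk]
      · simpa [Finsupp.single_apply, hij] using this
  unfold expMoebius
  by_cases h : ∀ i, k i ≤ 1
  · rw [if_pos h, if_pos (h1.2 h), map_add, Finsupp.degree_single, pow_succ]; ring
  · rw [if_neg h, if_neg (fun h' => h (h1.1 h')), neg_zero]

theorem sum_antidiagonal_expMoebius (k : ℕ →₀ ℕ) :
    ∑ p ∈ antidiagonal k, expMoebius p.1 = if k = 0 then 1 else 0 := by
  classical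
  split_ifs with hk
  · subst hk; simp [expMoebius_zero]
  obtain ⟨j, hj⟩ : ∃ j, k j ≠ 0 := by
    by_contra! h
    exact hk (Finsupp.ext h)
  set e := Finsupp.single j 1 with he
  have hej : e j = 1 := by simp [he]
  have hei : ∀ i, i ≠ j → e i = 0 := fun i hi => by simp [he, hi.symm]
  refine Finset.sum_involution (fun p _ => if p.1 j = 0 then (p.1 + e, p.2 - e) else
    if p.1 j = 1 then (p.1 - e, p.2 + e) else p) ?_ ?_ ?_ ?_
  · intro p _
    split_ifs with h0 h1
    · rw [expMoebius_add_single h0]; ring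
    · have h2 : p.1 = (p.1 - e) + e := by
        ext i
        by_cases hi : i = j
        · subst hi; simp [hej, h1]
        · simp [hei i hi]
      have h3 : (p.1 - e) j = 0 := by simp [hej, h1]
      nth_rewrite 1 [h2]
      rw [expMoebius_add_single h3]
      ring
    · have : ¬ ∀ j, p.1 j ≤ 1 := fun h => by have := h j; omega
      simp [expMoebius, this]
  · intro p _ hp
    split_ifs with h0 h1
    · intro h
      have := congrArg (fun q => q.1 j) h
      simp [hej] at this
    · intro h
      have := congrArg (fun q => q.1 j) h
      simp [hej, h1] at this
    · exfalso
      apply hp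
      have : ¬ ∀ j, p.1 j ≤ 1 := fun h => by have := h j; omega
      simp [expMoebius, this]
  · intro p hp
    have hp' := mem_antidiagonal.1 hp
    have hpi : ∀ i, p.1 i + p.2 i = k i := fun i => by rw [← hp']; rfl
    rw [mem_antidiagonal]
    split_ifs with h0 h1
    · ext i
      have := hpi i
      by_cases hi : i = j
      · subst hi; simp [hej]; omega
      · simp [hei i hi, this]
    · ext i
      have := hpi i
      by_cases hi : i = j
      · subst hi; simp [hej]; omega
      · simp [hei i hi, this]
    · exact hp'
  · intro p hp
    have hp' := mem_antidiagonal.1 hp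
    have hpj : p.1 j + p.2 j = k j := by rw [← hp']; rfl
    by_cases h0 : p.1 j = 0
    · have h2 : (p.1 + e) j = 1 := by simp [hej, h0]
      simp only [h0, if_true, h2, one_ne_zero, if_false]
      ext i
      · simp
      · by_cases hi : i = j
        · subst hi; simp [hej]; omega
        · simp [hei i hi]
    · by_cases h1 : p.1 j = 1
      · have h2 : (p.1 - e) j = 0 := by simp [hej, h1]
        simp only [h1, one_ne_zero, if_false, if_true, h2]
        ext i
        · by_cases hi : i = j
          · subst hi; simp [hej]; omega
          · simp [hei i hi]
        · simp
      · simp [h0, h1]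

/-- The number of ways to split an exponent vector, i.e. the divisor function. -/
noncomputable def numSplit (k : ℕ →₀ ℕ) : ℝ := ((antidiagonal k).card : ℝ)

theorem numSplit_nonneg (k : ℕ →₀ ℕ) : 0 ≤ numSplit k := Nat.cast_nonneg _

theorem numSplit_add_le (k l : ℕ →₀ ℕ) : numSplit (k + l) ≤ numSplit k * numSplit l := by
  classical
  unfold numSplit
  rw [← Nat.cast_mul, ← Finset.card_product]
  norm_cast
  refine Finset.card_le_card_of_injOn
    (fun p => ((p.1 ⊓ k, k - p.1 ⊓ k), (p.1 - p.1 ⊓ k, l - (p.1 - p.1 ⊓ k)))) ?_ ?_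
  · intro p hp
    have hp' := mem_antidiagonal.1 (Finset.mem_coe.1 hp)
    have hpi : ∀ i, p.1 i + p.2 i = k i + l i := fun i => by
      rw [← Finsupp.add_apply, hp', Finsupp.add_apply]
    simp only [Finset.coe_product, Set.mem_prod, Finset.mem_coe, mem_antidiagonal]
    constructor
    · ext i; simp
    · ext i
      have := hpi i
      simp only [Finsupp.add_apply, Finsupp.tsub_apply, Finsupp.inf_apply]
      omega
  · intro p hp q hq hpq
    have hp' := mem_antidiagonal.1 (Finset.mem_coe.1 hp)
    have hq' := mem_antidiagonal.1 (Finset.mem_coe.1 hq)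
    simp only [Prod.mk.injEq] at hpq
    have h1 : p.1 = q.1 := by
      ext i
      have a1 := DFunLike.congr_fun hpq.1.1 i
      have a2 := DFunLike.congr_fun hpq.2.1 i
      simp only [Finsupp.tsub_apply, Finsupp.inf_apply] at a1 a2
      omega
    refine Prod.ext h1 ?_
    have h2 := hp'.trans hq'.symm
    rw [h1] at h2
    exact add_left_cancel h2

end Antidiagonal

namespace LogSystem

open Finset.HasAntidiagonal (antidiagonal mem_antidiagonal)
open MeasureTheory Complex Real

/-- The generalized Dirichlet series of the system. -/
noncomputable def zetaSeries (ℓ : (ℕ →₀ ℕ) → ℝ) (s : ℂ) : ℂ := ∑' k, cexp (-s * ℓ k)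

/-- Coefficients of the mollifier. -/
noncomputable def molCoeff (ℓ : (ℕ →₀ ℕ) → ℝ) (L : ℝ) (k : ℕ →₀ ℕ) : ℂ :=
  if ℓ k ≤ L then expMoebius k else 0

/-- The mollifier: the truncated Dirichlet series of the Möbius function. -/
noncomputable def mol (ℓ : (ℕ →₀ ℕ) → ℝ) (L : ℝ) (s : ℂ) : ℂ :=
  ∑' k, molCoeff ℓ L k * cexp (-s * ℓ k)

/-- Coefficients of the mollified Dirichlet series minus one. -/
noncomputable def detCoeff (ℓ : (ℕ →₀ ℕ) → ℝ) (L : ℝ) (k : ℕ →₀ ℕ) : ℂ :=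
  (∑ p ∈ antidiagonal k, molCoeff ℓ L p.1) - if k = 0 then 1 else 0

theorem norm_molCoeff_le (ℓ : (ℕ →₀ ℕ) → ℝ) (L : ℝ) (k : ℕ →₀ ℕ) : ‖molCoeff ℓ L k‖ ≤ 1 := by
  unfold molCoeff
  split_ifs
  · exact norm_expMoebius_le k
  · simp

variable {ℓ : (ℕ →₀ ℕ) → ℝ} {θ A C : ℝ} (H : LogSystem ℓ θ A C)
include H

theorem map_zero : ℓ 0 = 0 := by
  have := H.map_add 0 0
  simpa using this

theorem cexp_add (s : ℂ) (k l : ℕ →₀ ℕ) :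
    cexp (-s * ℓ (k + l)) = cexp (-s * ℓ k) * cexp (-s * ℓ l) := by
  rw [H.map_add, ← Complex.exp_add]; congr 1; push_cast; ring

theorem mol_eq_sum (L : ℝ) (s : ℂ) :
    mol ℓ L s = ∑ k ∈ (H.finite L).toFinset, expMoebius k * cexp (-s * ℓ k) := by
  unfold mol
  rw [tsum_eq_sum (s := (H.finite L).toFinset)]
  · refine Finset.sum_congr rfl fun k hk => ?_
    have hk' : ℓ k ≤ L := by simpa using hk
    rw [molCoeff, if_pos hk']
  · intro k hk
    have hk' : ¬ ℓ k ≤ L := by simpa using hk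
    rw [molCoeff, if_neg hk', zero_mul]

theorem summable_norm_mul_cexp {a : (ℕ →₀ ℕ) → ℂ} (ha : ∀ k, ‖a k‖ ≤ 1) {s : ℂ} (hs : 1 < s.re) :
    Summable fun k => ‖a k * cexp (-s * ℓ k)‖ := by
  refine (H.summable_exp hs).of_nonneg_of_le (fun _ => norm_nonneg _) fun k => ?_
  rw [norm_mul, norm_cexp_mul]
  exact mul_le_of_le_one_left (Real.exp_pos _).le (ha k)

theorem zetaSeries_mul_moebius {s : ℂ} (hs : 1 < s.re) :
    (∑' k, expMoebius k * cexp (-s * ℓ k)) * zetaSeries ℓ s = 1 := by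
  have h := hasSum_antidiagonal_mul_char (H.cexp_add s) (a := expMoebius) (b := fun _ => 1)
    (H.summable_norm_mul_cexp norm_expMoebius_le hs)
    (H.summable_norm_mul_cexp (by simp) hs)
  simp only [mul_one, one_mul, sum_antidiagonal_expMoebius] at h
  unfold zetaSeries
  refine h.unique ?_
  have h' : (fun k => (if k = 0 then (1 : ℂ) else 0) * cexp (-s * ℓ k)) =
      fun k => if k = 0 then 1 else 0 := by
    funext k
    split_ifs with hk
    · rw [hk, H.map_zero]; simp
    · simp
  rw [h']
  exact hasSum_ite_eq (0 : ℕ →₀ ℕ) (1 : ℂ)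

theorem detCoeff_eq_zero {L : ℝ} {k : ℕ →₀ ℕ} (hk : ℓ k ≤ L) : detCoeff ℓ L k = 0 := by
  unfold detCoeff
  rw [← sum_antidiagonal_expMoebius, sub_eq_zero]
  refine Finset.sum_congr rfl fun p hp => ?_
  have h1 := H.map_add p.1 p.2
  rw [mem_antidiagonal.1 hp] at h1
  rw [molCoeff, if_pos (by linarith [H.nonneg p.2])]

theorem norm_detCoeff_le {L : ℝ} (hL : 0 ≤ L) (k : ℕ →₀ ℕ) : ‖detCoeff ℓ L k‖ ≤ numSplit k := by
  by_cases hk : k = 0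
  · subst hk
    rw [H.detCoeff_eq_zero (by rw [H.map_zero]; exact hL), norm_zero]
    exact numSplit_nonneg _
  · unfold detCoeff
    rw [if_neg hk, sub_zero]
    refine (norm_sum_le _ _).trans ((Finset.sum_le_sum fun p _ => norm_molCoeff_le ℓ L p.1).trans ?_)
    simp [numSplit]

theorem zetaSeries_mul_mol_sub_one {L : ℝ} {s : ℂ} (hs : 1 < s.re) :
    HasSum (fun k => detCoeff ℓ L k * cexp (-s * ℓ k)) (zetaSeries ℓ s * mol ℓ L s - 1) := by
  have h := hasSum_antidiagonal_mul_char (H.cexp_add s) (a := molCoeff ℓ L) (b := fun _ => 1)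
    (H.summable_norm_mul_cexp (norm_molCoeff_le ℓ L) hs)
    (H.summable_norm_mul_cexp (by simp) hs)
  simp only [mul_one, one_mul] at h
  have h2 : HasSum (fun k => (if k = 0 then (1 : ℂ) else 0) * cexp (-s * ℓ k)) 1 := by
    have h' : (fun k => (if k = 0 then (1 : ℂ) else 0) * cexp (-s * ℓ k)) =
        fun k => if k = 0 then 1 else 0 := by
      funext k
      split_ifs with hk
      · rw [hk, H.map_zero]; simp
      · simp
    rw [h']
    exact hasSum_ite_eq (0 : ℕ →₀ ℕ) (1 : ℂ)
  have h3 := h.sub h2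
  unfold detCoeff zetaSeries
  rw [mul_comm]
  simp_rw [sub_mul]
  exact h3

theorem exp_add (σ : ℝ) (k l : ℕ →₀ ℕ) :
    rexp (-σ * ℓ (k + l)) = rexp (-σ * ℓ k) * rexp (-σ * ℓ l) := by
  rw [H.map_add, ← Real.exp_add]; congr 1; ring

theorem hasSum_numSplit {σ : ℝ} (hσ : 1 < σ) :
    HasSum (fun k => numSplit k * rexp (-σ * ℓ k)) ((∑' k, rexp (-σ * ℓ k)) ^ 2) := by
  have hs : Summable fun k => ‖(1 : ℝ) * rexp (-σ * ℓ k)‖ := by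
    simpa using H.summable_exp hσ
  have h := hasSum_antidiagonal_mul_char (H.exp_add σ) (a := fun _ => 1) (b := fun _ => 1) hs hs
  simpa [numSplit, sq] using h

theorem sum_numSplit_sq_le {σ : ℝ} (hσ : 1 < σ) (F : Finset (ℕ →₀ ℕ)) :
    ∑ k ∈ F, numSplit k ^ 2 * rexp (-σ * ℓ k) ≤ ((A + C) * σ / (σ - 1)) ^ 4 := by
  have h1 := H.hasSum_numSplit hσ
  have hs : Summable fun k => ‖numSplit k * rexp (-σ * ℓ k)‖ := h1.summable.norm
  have h := hasSum_antidiagonal_mul_char (H.exp_add σ) hs hs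
  rw [h1.tsum_eq, ← sq, ← pow_mul] at h
  have hle : ∀ k, numSplit k ^ 2 * rexp (-σ * ℓ k) ≤
      (∑ p ∈ antidiagonal k, numSplit p.1 * numSplit p.2) * rexp (-σ * ℓ k) := by
    intro k
    refine mul_le_mul_of_nonneg_right ?_ (Real.exp_pos _).le
    calc numSplit k ^ 2 = ∑ p ∈ antidiagonal k, numSplit k := by
          rw [Finset.sum_const, nsmul_eq_mul, sq]; rfl
      _ ≤ _ := Finset.sum_le_sum fun p hp => by
          nth_rewrite 1 [← mem_antidiagonal.1 hp]
          exact numSplit_add_le _ _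
  have hn : ∀ k, 0 ≤ (∑ p ∈ antidiagonal k, numSplit p.1 * numSplit p.2) * rexp (-σ * ℓ k) :=
    fun k => (mul_nonneg (sq_nonneg _) (Real.exp_pos _).le).trans (hle k)
  calc _ ≤ _ := Finset.sum_le_sum fun k _ => hle k
    _ ≤ _ := sum_le_hasSum F (fun k _ => hn k) h
    _ ≤ _ := pow_le_pow_left₀ (tsum_nonneg fun _ => (Real.exp_pos _).le) (H.tsum_exp_le hσ) 4

theorem integral_norm_sq_zeta_mul_mol_sub_one_le {σ L T B : ℝ} (hσ : 1 < σ) (hL : 0 ≤ L)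
    (hT : 1 ≤ T) (hB : T * rexp (-(1 - θ) * L) ≤ B) :
    ∫ t in -T..T, ‖zetaSeries ℓ (σ + t * I) * mol ℓ L (σ + t * I) - 1‖ ^ 2 ≤
      8 * π * rexp 2 * (A + 2 * C) *
        ((1 + B) * ((A + C) * (2 * σ - 1) / (2 * σ - 2)) ^ 4) := by
  set a : (ℕ →₀ ℕ) → ℂ := fun k => detCoeff ℓ L k * (rexp (-σ * ℓ k) : ℂ) with ha
  have hB0 : 0 ≤ B := le_trans (by positivity) hB
  have hna : ∀ k, ‖a k‖ = ‖detCoeff ℓ L k‖ * rexp (-σ * ℓ k) := by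
    intro k
    simp only [ha]
    rw [norm_mul, Complex.norm_real, Real.norm_eq_abs, abs_of_pos (Real.exp_pos _)]
  have hsum : ∀ t : ℝ, zetaSeries ℓ (σ + t * I) * mol ℓ L (σ + t * I) - 1 =
      ∑' k, a k * cexp (-(t * ℓ k) * I) := by
    intro t
    rw [← (H.zetaSeries_mul_mol_sub_one (L := L) (s := σ + t * I) (by simpa using hσ)).tsum_eq]
    congr 1
    ext k
    simp only [ha]
    rw [Complex.ofReal_exp, mul_assoc, ← Complex.exp_add]
    congr 2
    push_cast
    ring
  simp_rw [hsum]
  refine H.mean_value_tsum a ?_ hT fun F => ?_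
  · refine (H.hasSum_numSplit hσ).summable.of_nonneg_of_le (fun _ => norm_nonneg _) fun k => ?_
    rw [hna]
    exact mul_le_mul_of_nonneg_right (H.norm_detCoeff_le hL k) (Real.exp_pos _).le
  · have h1 := H.sum_numSplit_sq_le (σ := 2 * σ - 1) (by linarith) F
    rw [show 2 * σ - 1 - 1 = 2 * σ - 2 by ring] at h1
    refine le_trans ?_ (mul_le_mul_of_nonneg_left h1 (by linarith))
    rw [Finset.mul_sum]
    refine Finset.sum_le_sum fun k _ => ?_
    by_cases hk : ℓ k ≤ L
    · rw [hna, H.detCoeff_eq_zero hk, norm_zero]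
      simp
      positivity
    · push Not at hk
      rw [hna, mul_pow]
      have h2 : rexp (ℓ k) + T * rexp (θ * ℓ k) ≤ (1 + B) * rexp (ℓ k) := by
        have : T * rexp (θ * ℓ k) ≤ B * rexp (ℓ k) := by
          calc T * rexp (θ * ℓ k) = T * rexp (-(1 - θ) * ℓ k) * rexp (ℓ k) := by
                rw [mul_assoc, ← Real.exp_add]; congr 2; ring
            _ ≤ T * rexp (-(1 - θ) * L) * rexp (ℓ k) := by
                gcongr ?_ * _
                refine mul_le_mul_of_nonneg_left (Real.exp_le_exp.2 ?_) (by linarith)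
                nlinarith [H.theta_lt_one]
            _ ≤ _ := by gcongr
        linarith
      calc _ ≤ numSplit k ^ 2 * rexp (-σ * ℓ k) ^ 2 * ((1 + B) * rexp (ℓ k)) := by
            gcongr
            exact H.norm_detCoeff_le hL k
        _ = _ := by
            rw [show -(2 * σ - 1) * ℓ k = -σ * ℓ k + -σ * ℓ k + ℓ k by ring, Real.exp_add,
              Real.exp_add]
            ring

end LogSystem

namespace LogSystem

open MeasureTheory Complex Real

/-- The analytic continuation of the generalized Dirichlet series. -/
noncomputable def zetaCont (ℓ : (ℕ →₀ ℕ) → ℝ) (A : ℝ) (s : ℂ) : ℂ :=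
  A * s / (s - 1) + s * lap ℓ A s

theorem integral_inv_one_add_sq_le (T : ℝ) : ∫ t in -T..T, (1 + t ^ 2)⁻¹ ≤ π := by
  rw [integral_inv_one_add_sq, Real.arctan_neg]
  linarith [Real.arctan_lt_pi_div_two T]

variable {ℓ : (ℕ →₀ ℕ) → ℝ} {θ A C : ℝ} (H : LogSystem ℓ θ A C)
include H

theorem zetaCont_eq {s : ℂ} (hs : 1 < s.re) : zetaCont ℓ A s = zetaSeries ℓ s :=
  (H.tsum_cexp_eq_lap hs).symm

theorem continuous_lap_line {σ : ℝ} (hσ : θ < σ) :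
    Continuous fun t : ℝ => lap ℓ A (σ + t * I) := by
  rw [continuous_iff_continuousAt]
  intro t
  have h1 : ContinuousAt (lap ℓ A) (σ + t * I) :=
    (H.differentiableAt_lap (by simpa using hσ)).continuousAt
  exact ContinuousAt.comp (f := fun t : ℝ => (σ + t * I : ℂ)) h1
    (by fun_prop : Continuous fun t : ℝ => (σ + t * I : ℂ)).continuousAt

theorem continuous_zetaCont_line {σ : ℝ} (hσ : θ < σ) (hσ1 : σ ≠ 1) :
    Continuous fun t : ℝ => zetaCont ℓ A (σ + t * I) := by
  have h1 := H.continuous_lap_line hσ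
  unfold zetaCont
  have h2 : ∀ t : ℝ, (σ + t * I - 1 : ℂ) ≠ 0 := by
    intro t h
    have := congrArg Complex.re h
    simp at this
    exact hσ1 (by linarith)
  fun_prop (disch := exact h2)

theorem sum_exp_neg_le {L : ℝ} (hL : 0 ≤ L) :
    ∑ k ∈ (H.finite L).toFinset, rexp (-ℓ k) ≤ rexp 1 * ((A + C) * (L + 2)) := by
  have h1 := H.sum_exp_le (σ := 1 + 1 / (L + 1)) (by simp; positivity) (H.finite L).toFinset
  have h2 : (A + C) * (1 + 1 / (L + 1)) / (1 + 1 / (L + 1) - 1) = (A + C) * (L + 2) := by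
    field_simp
    ring
  rw [h2] at h1
  refine le_trans ?_ (mul_le_mul_of_nonneg_left h1 (Real.exp_pos 1).le)
  rw [Finset.mul_sum]
  refine Finset.sum_le_sum fun k hk => ?_
  have hk' : ℓ k ≤ L := by simpa using hk
  rw [← Real.exp_add]
  apply Real.exp_le_exp.2
  have : 1 / (L + 1) * ℓ k ≤ 1 := by
    rw [one_div_mul_eq_div, div_le_one (by positivity)]
    linarith
  linarith

theorem integral_norm_sq_sum_le {a : (ℕ →₀ ℕ) → ℂ} (ha : ∀ k, ‖a k‖ ≤ 1) {L U : ℝ} (hL : 0 ≤ L)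
    (hU : 1 ≤ U) (hLU : rexp ((1 - θ) * L) = U) :
    ∫ t in -U..U, ‖∑ k ∈ (H.finite L).toFinset,
        a k * cexp (-(((1 + θ) / 2 : ℝ) + t * I) * ℓ k)‖ ^ 2 ≤
      8 * π * rexp 2 * (A + 2 * C) * (2 * U * (rexp 1 * ((A + C) * (L + 2)))) := by
  have hA := H.A_pos
  have hC := H.C_nonneg
  have h1 := H.mean_value (H.finite L).toFinset
    (fun k => a k * (rexp (-((1 + θ) / 2) * ℓ k) : ℂ)) hU
  have h2 : ∀ t : ℝ, ∀ k, a k * cexp (-(((1 + θ) / 2 : ℝ) + t * I) * ℓ k) =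
      a k * (rexp (-((1 + θ) / 2) * ℓ k) : ℂ) * cexp (-(t * ℓ k) * I) := by
    intro t k
    rw [Complex.ofReal_exp, mul_assoc, ← Complex.exp_add]
    congr 2
    push_cast
    ring
  simp_rw [h2]
  refine h1.trans ?_
  refine mul_le_mul_of_nonneg_left ?_ (by positivity)
  refine le_trans ?_ (mul_le_mul_of_nonneg_left (H.sum_exp_neg_le hL) (by linarith))
  rw [Finset.mul_sum]
  refine Finset.sum_le_sum fun k hk => ?_
  have hk' : ℓ k ≤ L := by simpa using hk
  rw [norm_mul, Complex.norm_real, Real.norm_eq_abs, abs_of_pos (Real.exp_pos _)]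
  have h3 : rexp (-((1 + θ) / 2) * ℓ k) ^ 2 = rexp (-(1 + θ) * ℓ k) := by
    rw [← Real.exp_nat_mul]; congr 1; push_cast; ring
  have h4 : rexp (ℓ k) ≤ U * rexp (θ * ℓ k) := by
    rw [← hLU, ← Real.exp_add]
    apply Real.exp_le_exp.2
    nlinarith [H.theta_lt_one]
  calc _ ≤ (1 * rexp (-((1 + θ) / 2) * ℓ k)) ^ 2 * (U * rexp (θ * ℓ k) + U * rexp (θ * ℓ k)) := by
        gcongr
        exact ha k
    _ = 2 * U * (rexp (-(1 + θ) * ℓ k) * rexp (θ * ℓ k)) := by rw [one_mul, h3]; ring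
    _ = _ := by rw [← Real.exp_add]; congr 2; ring

theorem integral_norm_sq_mol_le {L U : ℝ} (hL : 0 ≤ L) (hU : 1 ≤ U)
    (hLU : rexp ((1 - θ) * L) = U) :
    ∫ t in -U..U, ‖mol ℓ L (((1 + θ) / 2 : ℝ) + t * I)‖ ^ 2 ≤
      8 * π * rexp 2 * (A + 2 * C) * (2 * U * (rexp 1 * ((A + C) * (L + 2)))) := by
  simp_rw [H.mol_eq_sum]
  exact H.integral_norm_sq_sum_le norm_expMoebius_le hL hU hLU

theorem integral_cnt_Ioc {s : ℂ} (hs : s ≠ 0) (L : ℝ) :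
    s * ∫ y in Set.Ioc 0 L, (cnt ℓ y : ℂ) * cexp (-s * y) =
      (∑ k ∈ (H.finite L).toFinset, cexp (-s * ℓ k)) - cnt ℓ L * cexp (-s * L) := by
  have hi : ∀ k, IntegrableOn ((Set.Ici (ℓ k)).indicator fun y : ℝ => cexp (-s * y))
      (Set.Ioc 0 L) := fun k =>
    (((by fun_prop : Continuous fun y : ℝ => cexp (-s * y)).continuousOn.integrableOn_Icc).mono_set
      Set.Ioc_subset_Icc_self).indicator measurableSet_Ici
  have h1 : ∫ y in Set.Ioc 0 L, (cnt ℓ y : ℂ) * cexp (-s * y) =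
      ∫ y in Set.Ioc 0 L, ∑ k ∈ (H.finite L).toFinset,
        (Set.Ici (ℓ k)).indicator (fun y : ℝ => cexp (-s * y)) y := by
    refine setIntegral_congr_fun measurableSet_Ioc fun y hy => ?_
    refine (H.hasSum_indicator s y).unique (hasSum_sum_of_ne_finset_zero fun k hk => ?_)
    have hk' : ¬ ℓ k ≤ L := by simpa using hk
    refine Set.indicator_of_notMem (fun h => hk' ?_) _
    exact le_trans h hy.2
  rw [h1, integral_finsetSum _ fun k _ => hi k, Finset.mul_sum]
  have h2 : ∀ k ∈ (H.finite L).toFinset, s * ∫ y in Set.Ioc 0 L,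
      (Set.Ici (ℓ k)).indicator (fun y : ℝ => cexp (-s * y)) y =
      cexp (-s * ℓ k) - cexp (-s * L) := by
    intro k hk
    have hk' : ℓ k ≤ L := by simpa using hk
    have hk0 := H.nonneg k
    rw [setIntegral_indicator measurableSet_Ici]
    have h3 : (Set.Ioc 0 L ∩ Set.Ici (ℓ k) : Set ℝ) =ᵐ[volume] Set.Ioc (ℓ k) L := by
      have h4 : (Set.Ioc 0 L ∩ Set.Ici (ℓ k) : Set ℝ) =ᵐ[volume]
        (Set.Ioc 0 L ∩ Set.Ioi (ℓ k) : Set ℝ) := (ae_eq_refl _).inter Ioi_ae_eq_Ici.symm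
      rwa [Set.Ioc_inter_Ioi, max_eq_right hk0] at h4
    rw [setIntegral_congr_set h3, ← intervalIntegral.integral_of_le hk',
      integral_exp_mul_complex (neg_ne_zero.2 hs)]
    field_simp
    ring
  rw [Finset.sum_congr rfl h2, Finset.sum_sub_distrib, Finset.sum_const, nsmul_eq_mul]
  congr 2
  unfold cnt
  rw [Set.ncard_eq_toFinset_card _ (H.finite L)]
  simp

theorem zetaCont_eq_sum_add {s : ℂ} (hs : θ < s.re) (hs1 : s ≠ 1) {L : ℝ} (hL : 0 ≤ L) :
    zetaCont ℓ A s = (∑ k ∈ (H.finite L).toFinset, cexp (-s * ℓ k)) +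
      (A * cexp ((1 - s) * L) / (s - 1) - err ℓ A L * cexp (-s * L) +
        s * ∫ y in Set.Ioi L, (err ℓ A y : ℂ) * cexp (-s * y)) := by
  have hs0 : s ≠ 0 := by
    rintro rfl
    have := H.theta_nonneg
    simp at hs
    linarith
  have hs1' : s - 1 ≠ 0 := sub_ne_zero.2 hs1
  have hI := H.integrableOn_err_mul_cexp hs 0
  have h1 : lap ℓ A s = (∫ y in Set.Ioc 0 L, (err ℓ A y : ℂ) * cexp (-s * y)) +
      ∫ y in Set.Ioi L, (err ℓ A y : ℂ) * cexp (-s * y) := by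
    unfold lap
    rw [← Set.Ioc_union_Ioi_eq_Ioi hL]
    exact setIntegral_union Set.Ioc_disjoint_Ioi_same measurableSet_Ioi
      (hI.mono_set Set.Ioc_subset_Ioi_self) (hI.mono_set (Set.Ioi_subset_Ioi hL))
  have hE : IntegrableOn (fun y : ℝ => (A : ℂ) * cexp ((1 - s) * y)) (Set.Ioc 0 L) :=
    ((by fun_prop : Continuous fun y : ℝ => (A : ℂ) * cexp ((1 - s) * y)).continuousOn.integrableOn_Icc).mono_set
      Set.Ioc_subset_Icc_self
  have h2 : ∫ y in Set.Ioc 0 L, (cnt ℓ y : ℂ) * cexp (-s * y) =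
      (∫ y in Set.Ioc 0 L, (err ℓ A y : ℂ) * cexp (-s * y)) +
        A * ((cexp ((1 - s) * L) - 1) / (1 - s)) := by
    have h3 : ∀ y : ℝ, (cnt ℓ y : ℂ) * cexp (-s * y) =
        (err ℓ A y : ℂ) * cexp (-s * y) + A * cexp ((1 - s) * y) := by
      intro y
      have : cexp ((1 - s) * y) = cexp y * cexp (-s * y) := by
        rw [← Complex.exp_add]; congr 1; ring
      rw [this]
      unfold err
      push_cast
      ring
    simp_rw [h3]
    rw [integral_add (hI.mono_set Set.Ioc_subset_Ioi_self) hE, integral_const_mul,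
      ← intervalIntegral.integral_of_le hL, ← intervalIntegral.integral_of_le hL,
      integral_exp_mul_complex (sub_ne_zero.2 (Ne.symm hs1))]
    simp
  have h4 := H.integral_cnt_Ioc hs0 L
  rw [h2] at h4
  have h5 : (cnt ℓ L : ℂ) * cexp (-s * L) = err ℓ A L * cexp (-s * L) + A * cexp ((1 - s) * L) := by
    have : cexp ((1 - s) * L) = cexp L * cexp (-s * L) := by
      rw [← Complex.exp_add]; congr 1; ring
    rw [this]
    unfold err
    push_cast
    ring
  rw [h5] at h4
  have h6 : (1 : ℂ) - s ≠ 0 := sub_ne_zero.2 (Ne.symm hs1)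
  unfold zetaCont
  rw [h1, mul_add s, show s * ∫ y in Set.Ioc 0 L, (err ℓ A y : ℂ) * cexp (-s * y) =
    ((∑ k ∈ (H.finite L).toFinset, cexp (-s * ℓ k)) -
      (err ℓ A L * cexp (-s * L) + A * cexp ((1 - s) * L))) -
      s * (A * ((cexp ((1 - s) * L) - 1) / (1 - s))) by rw [← h4]; ring]
  rw [show (1 : ℂ) - s = -(s - 1) by ring]
  field_simp
  ring

theorem integral_norm_sq_zetaCont_le : ∃ D, 0 ≤ D ∧ ∀ L U : ℝ, 0 ≤ L → 1 ≤ U →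
    rexp ((1 - θ) * L) = U →
    ∫ t in -U..U, ‖zetaCont ℓ A (((1 + θ) / 2 : ℝ) + t * I)‖ ^ 2 ≤ D * (U * (L + 2)) := by
  have hA := H.A_pos
  have hC := H.C_nonneg
  have hθ : 0 < 1 - θ := sub_pos.2 H.theta_lt_one
  have hθ0 := H.theta_nonneg
  set K₁ := 8 * π * rexp 2 * (A + 2 * C) * (2 * (rexp 1 * (A + C))) with hK₁
  set K₂ := 4 * A ^ 2 / (1 - θ) ^ 2 * π with hK₂
  set K₃ := 2 * (2 * π * rexp 1 * (C ^ 2 / (1 - θ))) with hK₃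
  refine ⟨4 * (K₁ + K₂ + 2 * C ^ 2 + K₃), by positivity, fun L U hL hU hLU => ?_⟩
  have hU0 : 0 < U := by linarith
  set σ : ℝ := (1 + θ) / 2 with hσ
  have hσθ : θ < σ := by rw [hσ]; linarith
  have hσ1 : σ < 1 := by rw [hσ]; linarith
  set g : ℝ → ℂ := (Set.Ioi L).indicator fun y => (err ℓ A y : ℂ) * cexp (-(σ : ℂ) * y) with hg
  have hgi : Integrable g := (integrable_indicator_iff measurableSet_Ioi).2
    (H.integrableOn_err_mul_cexp (by simpa using hσθ) L)
  have hgle : ∀ y, ‖g y‖ ^ 2 ≤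
      (Set.Ioi L).indicator (fun y => C ^ 2 * rexp (-(1 - θ) * y)) y := by
    intro y
    simp only [hg, Set.indicator_apply]
    split_ifs
    · have h1 := H.norm_err_mul_cexp_le σ y
      calc _ ≤ (C * rexp (-(σ - θ) * y)) ^ 2 := by gcongr; simpa using h1
        _ = _ := by
          rw [mul_pow, ← Real.exp_nat_mul]; congr 2; rw [hσ]; push_cast; ring
    · simp
  have hdi : Integrable ((Set.Ioi L).indicator (fun y => C ^ 2 * rexp (-(1 - θ) * y))) :=
    (integrable_indicator_iff measurableSet_Ioi).2 ((integrableOn_exp_Ioi hθ L).const_mul _)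
  have hg2 : Integrable fun y => ‖g y‖ ^ 2 := by
    refine hdi.mono' (hgi.aestronglyMeasurable.norm.pow 2) (Eventually.of_forall fun y => ?_)
    rw [Real.norm_eq_abs, abs_of_nonneg (sq_nonneg _)]
    exact hgle y
  have hgI : ∫ y, ‖g y‖ ^ 2 ≤ C ^ 2 / (1 - θ) / U := by
    refine (integral_mono hg2 hdi hgle).trans_eq ?_
    rw [integral_indicator measurableSet_Ioi, integral_const_mul, integral_exp_Ioi hθ, ← hLU,
      neg_mul, Real.exp_neg]
    field_simp
  have hBes := (integral_norm_sq_fourier_le hgi hg2 hU0).trans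
    (mul_le_mul_of_nonneg_left hgI (by positivity))
  have hcont := continuous_fourier_integral hgi
  have hpt : ∀ t ∈ Set.Icc (-U) U, ‖zetaCont ℓ A (σ + t * I)‖ ^ 2 ≤
      4 * (‖∑ k ∈ (H.finite L).toFinset, (1 : ℂ) * cexp (-((σ : ℂ) + t * I) * ℓ k)‖ ^ 2 +
        4 * A ^ 2 / (1 - θ) ^ 2 * U * (1 + t ^ 2)⁻¹ + C ^ 2 +
        2 * U ^ 2 * ‖∫ y, g y * cexp (-(t * y) * I)‖ ^ 2) := by
    intro t ht
    set s : ℂ := σ + t * I with hs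
    have hsre : s.re = σ := by simp [hs]
    have hs1 : s ≠ 1 := fun h => by
      rw [h] at hsre; simp at hsre; linarith
    have hG : ∫ y in Set.Ioi L, (err ℓ A y : ℂ) * cexp (-s * y) =
        ∫ y, g y * cexp (-(t * y) * I) := by
      rw [← integral_indicator measurableSet_Ioi]
      congr 1
      ext y
      simp only [hg, Set.indicator_apply]
      split_ifs
      · rw [mul_assoc, ← Complex.exp_add, hs]; congr 2; ring
      · simp
    rw [H.zetaCont_eq_sum_add (hsre ▸ hσθ) hs1 hL, hG]
    simp only [one_mul]
    set a := ∑ k ∈ (H.finite L).toFinset, cexp (-s * ℓ k)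
    have hb : ‖A * cexp ((1 - s) * L) / (s - 1)‖ ^ 2 ≤ 4 * A ^ 2 / (1 - θ) ^ 2 * U * (1 + t ^ 2)⁻¹ := by
      have h1 : ‖s - 1‖ ^ 2 = ((1 - θ) / 2) ^ 2 + t ^ 2 := by
        rw [← Complex.normSq_eq_norm_sq, Complex.normSq_apply]
        simp [hs, hσ]
        ring
      have h2 : ‖cexp ((1 - s) * L)‖ ^ 2 = U := by
        rw [Complex.norm_exp, ← Real.exp_nat_mul, ← hLU]
        congr 1
        simp [hsre, hσ]
        ring
      rw [norm_div, norm_mul, div_pow, mul_pow, h1, h2, Complex.norm_real, Real.norm_eq_abs, sq_abs,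
        div_le_iff₀ (by positivity)]
      have h3 : ((1 - θ) / 2) ^ 2 * (1 + t ^ 2) ≤ ((1 - θ) / 2) ^ 2 + t ^ 2 := by
        have : ((1 - θ) / 2) ^ 2 ≤ 1 := by
          rw [sq_le_one_iff_abs_le_one, abs_of_pos (by linarith)]; linarith
        nlinarith [sq_nonneg t]
      calc A ^ 2 * U = 4 * A ^ 2 / (1 - θ) ^ 2 * U * (1 + t ^ 2)⁻¹ *
            (((1 - θ) / 2) ^ 2 * (1 + t ^ 2)) := by field_simp; ring
        _ ≤ _ := by gcongr
    have hc : ‖err ℓ A L * cexp (-s * L)‖ ^ 2 ≤ C ^ 2 := by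
      have h1 := H.norm_err_mul_cexp_le s L
      have h2 : rexp (-(s.re - θ) * L) ≤ 1 := by
        rw [Real.exp_le_one_iff, hsre]; nlinarith
      exact pow_le_pow_left₀ (norm_nonneg _) (h1.trans (mul_le_of_le_one_right hC h2)) 2
    have hd : ‖s * ∫ y, g y * cexp (-(t * y) * I)‖ ^ 2 ≤
        2 * U ^ 2 * ‖∫ y, g y * cexp (-(t * y) * I)‖ ^ 2 := by
      rw [norm_mul, mul_pow]
      gcongr
      have h1 : ‖s‖ ^ 2 = σ ^ 2 + t ^ 2 := by
        rw [← Complex.normSq_eq_norm_sq, Complex.normSq_apply]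
        simp [hs]
        ring
      rw [h1]
      nlinarith [abs_le.2 ht, sq_abs t, ht.1, ht.2]
    set b := A * cexp ((1 - s) * L) / (s - 1)
    set c := err ℓ A L * cexp (-s * L)
    set d := s * ∫ y, g y * cexp (-(t * y) * I)
    have h4 : ‖a + (b - c + d)‖ ≤ ‖a‖ + ‖b‖ + ‖c‖ + ‖d‖ := by
      calc _ ≤ ‖a‖ + (‖b - c‖ + ‖d‖) := (norm_add_le _ _).trans (by gcongr; exact norm_add_le _ _)
        _ ≤ ‖a‖ + ((‖b‖ + ‖c‖) + ‖d‖) := by gcongr; exact norm_sub_le _ _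
        _ = _ := by ring
    have h5 := pow_le_pow_left₀ (norm_nonneg _) h4 2
    nlinarith [sq_nonneg (‖a‖ - ‖b‖), sq_nonneg (‖a‖ - ‖c‖), sq_nonneg (‖a‖ - ‖d‖),
      sq_nonneg (‖b‖ - ‖c‖), sq_nonneg (‖b‖ - ‖d‖), sq_nonneg (‖c‖ - ‖d‖)]
  have hUU : -U ≤ U := by linarith
  have i1 : IntervalIntegrable (fun t : ℝ => ‖∑ k ∈ (H.finite L).toFinset,
      (1 : ℂ) * cexp (-((σ : ℂ) + t * I) * ℓ k)‖ ^ 2) volume (-U) U :=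
    Continuous.intervalIntegrable (by fun_prop) _ _
  have hne : ∀ t : ℝ, 1 + t ^ 2 ≠ 0 := fun t => by positivity
  have i2 : IntervalIntegrable (fun t : ℝ => 4 * A ^ 2 / (1 - θ) ^ 2 * U * (1 + t ^ 2)⁻¹)
      volume (-U) U := Continuous.intervalIntegrable (by fun_prop (disch := exact hne)) _ _
  have i3 : IntervalIntegrable (fun _ : ℝ => C ^ 2) volume (-U) U := by simp
  have i4 : IntervalIntegrable (fun t : ℝ => 2 * U ^ 2 * ‖∫ y, g y * cexp (-(t * y) * I)‖ ^ 2)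
      volume (-U) U := Continuous.intervalIntegrable (by fun_prop) _ _
  have hmono := intervalIntegral.integral_mono_on hUU
    (((H.continuous_zetaCont_line hσθ hσ1.ne).norm.pow 2).intervalIntegrable _ _)
    ((((i1.add i2).add i3).add i4).const_mul 4) hpt
  refine hmono.trans ?_
  rw [intervalIntegral.integral_const_mul, intervalIntegral.integral_add ((i1.add i2).add i3) i4,
    intervalIntegral.integral_add (i1.add i2) i3, intervalIntegral.integral_add i1 i2,
    intervalIntegral.integral_const_mul, intervalIntegral.integral_const_mul,
    intervalIntegral.integral_const]
  have b1 := H.integral_norm_sq_sum_le (a := fun _ => 1) (by simp) hL hU hLU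
  rw [← hσ] at b1
  have b2 := mul_le_mul_of_nonneg_left (integral_inv_one_add_sq_le U)
    (show 0 ≤ 4 * A ^ 2 / (1 - θ) ^ 2 * U by positivity)
  have b4 := mul_le_mul_of_nonneg_left hBes (show 0 ≤ 2 * U ^ 2 by positivity)
  have e1 : 8 * π * rexp 2 * (A + 2 * C) * (2 * U * (rexp 1 * ((A + C) * (L + 2)))) =
      K₁ * (U * (L + 2)) := by rw [hK₁]; ring
  have e2 : 4 * A ^ 2 / (1 - θ) ^ 2 * U * π = K₂ * U := by rw [hK₂]; ring
  have e4 : 2 * U ^ 2 * (2 * π * rexp 1 * (C ^ 2 / (1 - θ) / U)) = K₃ * U := by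
    rw [hK₃]; field_simp
  rw [e1] at b1
  rw [e2] at b2
  rw [e4] at b4
  have hK₂0 : 0 ≤ K₂ := by positivity
  have hK₃0 : 0 ≤ K₃ := by positivity
  have hUL : U ≤ U * (L + 2) := le_mul_of_one_le_right hU0.le (by linarith)
  have hUL' : 2 * U ≤ 2 * (U * (L + 2)) := by linarith
  have c2 := mul_le_mul_of_nonneg_left hUL hK₂0
  have c3 := mul_le_mul_of_nonneg_left hUL' (sq_nonneg C)
  have c4 := mul_le_mul_of_nonneg_left hUL hK₃0
  simp only [smul_eq_mul]
  linarith

end LogSystem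

open MeasureTheory in
theorem two_mul_card_le_of_local {s : Finset ℂ} {D T : ℝ} (hT : 0 ≤ T) (him : ∀ z ∈ s, |z.im| ≤ T)
    (hD : ∀ τ, ((s.filter fun z => |z.im - τ| ≤ 1).card : ℝ) ≤ D) :
    2 * (s.card : ℝ) ≤ 2 * (T + 1) * D := by
  have hi : ∀ z : ℂ, IntervalIntegrable
      ((Set.Icc (z.im - 1) (z.im + 1)).indicator fun _ => (1 : ℝ)) volume (-(T + 1)) (T + 1) :=
    fun z => ((integrable_indicator_iff measurableSet_Icc).2
      (integrableOn_const (by simp))).intervalIntegrable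
  have h1 : ∀ z ∈ s, ∫ u in -(T + 1)..(T + 1),
      (Set.Icc (z.im - 1) (z.im + 1)).indicator (fun _ => (1 : ℝ)) u = 2 := by
    intro z hz
    have hz' := abs_le.1 (him z hz)
    rw [intervalIntegral.integral_of_le (by linarith), ← integral_Icc_eq_integral_Ioc,
      setIntegral_indicator measurableSet_Icc,
      Set.inter_eq_self_of_subset_right (Set.Icc_subset_Icc (by linarith) (by linarith))]
    simp
    norm_num
  have h2 : ∫ u in -(T + 1)..(T + 1), ∑ z ∈ s,
      (Set.Icc (z.im - 1) (z.im + 1)).indicator (fun _ => (1 : ℝ)) u = 2 * s.card := by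
    rw [intervalIntegral.integral_finsetSum fun z _ => hi z, Finset.sum_congr rfl h1]
    simp [mul_comm]
  rw [← h2]
  have h3 : ∫ u in -(T + 1)..(T + 1), D = 2 * (T + 1) * D := by
    rw [intervalIntegral.integral_const, smul_eq_mul]; ring
  rw [← h3]
  have hsum := IntervalIntegrable.sum s (f := fun z : ℂ =>
    ((Set.Icc (z.im - 1) (z.im + 1)).indicator fun _ => (1 : ℝ))) (fun z _ => hi z)
  refine intervalIntegral.integral_mono_on (by linarith) ?_ (by simp) fun u _ => ?_
  · simpa only [Finset.sum_fn] using hsum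
  · refine le_trans (le_of_eq ?_) (hD u)
    rw [← Finset.sum_boole]
    refine Finset.sum_congr rfl fun z _ => ?_
    have : u ∈ Set.Icc (z.im - 1) (z.im + 1) ↔ |z.im - u| ≤ 1 := by
      rw [abs_le, Set.mem_Icc]; constructor <;> rintro ⟨h, h'⟩ <;> constructor <;> linarith
    simp only [Set.indicator_apply, this]

open MeasureTheory in
theorem sum_gaussian_le_of_local {s : Finset ℂ} {D : ℝ}
    (hD : ∀ τ, ((s.filter fun z => |z.im - τ| ≤ 1).card : ℝ) ≤ D) (t : ℝ) :
    ∑ z ∈ s, Real.exp (-(t - z.im) ^ 2) ≤ Real.exp 1 / 2 * √(2 * Real.pi) * D := by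
  have hG : Integrable fun u : ℝ => Real.exp (-(1 / 2) * (t - u) ^ 2) :=
    (integrable_exp_neg_mul_sq (by norm_num : (0 : ℝ) < 1 / 2)).comp_sub_left t
  have hGI : ∫ u : ℝ, Real.exp (-(1 / 2) * (t - u) ^ 2) = √(2 * Real.pi) := by
    rw [integral_sub_left_eq_self (fun u : ℝ => Real.exp (-(1 / 2) * u ^ 2)), integral_gaussian]
    congr 1; ring
  have hi : ∀ z : ℂ, Integrable
      ((Set.Icc (z.im - 1) (z.im + 1)).indicator fun u => Real.exp (-(1 / 2) * (t - u) ^ 2)) :=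
    fun z => hG.indicator measurableSet_Icc
  have h1 : ∀ z ∈ s, Real.exp (-(t - z.im) ^ 2) ≤ Real.exp 1 / 2 * ∫ u,
      (Set.Icc (z.im - 1) (z.im + 1)).indicator (fun u => Real.exp (-(1 / 2) * (t - u) ^ 2)) u := by
    intro z _
    rw [integral_indicator measurableSet_Icc]
    have h2 : Real.exp (-(t - z.im) ^ 2 - 1) * 2 ≤
        ∫ u in Set.Icc (z.im - 1) (z.im + 1), Real.exp (-(1 / 2) * (t - u) ^ 2) := by
      have h3 : ∫ u in Set.Icc (z.im - 1) (z.im + 1), Real.exp (-(t - z.im) ^ 2 - 1) =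
          Real.exp (-(t - z.im) ^ 2 - 1) * 2 := by
        simp
        ring_nf
      rw [← h3]
      refine setIntegral_mono_on (integrableOn_const (by simp)) hG.integrableOn measurableSet_Icc
        fun u hu => Real.exp_le_exp.2 ?_
      nlinarith [sq_nonneg (t - z.im - (z.im - u)), hu.1, hu.2]
    calc Real.exp (-(t - z.im) ^ 2) =
        Real.exp 1 / 2 * (Real.exp (-(t - z.im) ^ 2 - 1) * 2) := by
          rw [Real.exp_sub]; field_simp
      _ ≤ _ := by gcongr
  refine (Finset.sum_le_sum h1).trans ?_
  rw [← Finset.mul_sum, ← integral_finsetSum _ fun z _ => hi z, mul_assoc]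
  refine mul_le_mul_of_nonneg_left ?_ (by positivity)
  rw [← hGI, ← integral_mul_const]
  refine integral_mono (integrable_finsetSum _ fun z _ => hi z) (hG.mul_const D) fun u => ?_
  have h4 : ∑ z ∈ s, (Set.Icc (z.im - 1) (z.im + 1)).indicator
      (fun u => Real.exp (-(1 / 2) * (t - u) ^ 2)) u =
      Real.exp (-(1 / 2) * (t - u) ^ 2) * ((s.filter fun z => |z.im - u| ≤ 1).card : ℝ) := by
    rw [← Finset.sum_boole, Finset.mul_sum]
    refine Finset.sum_congr rfl fun z _ => ?_
    have : u ∈ Set.Icc (z.im - 1) (z.im + 1) ↔ |z.im - u| ≤ 1 := by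
      rw [abs_le, Set.mem_Icc]; constructor <;> rintro ⟨h, h'⟩ <;> constructor <;> linarith
    simp only [Set.indicator_apply, this]
    split_ifs <;> simp
  simp only
  rw [h4]
  exact mul_le_mul_of_nonneg_left (hD u) (Real.exp_pos _).le

namespace LogSystem

open MeasureTheory Complex Real

/-- The continuation with the pole at `1` removed. -/
noncomputable def zetaReg (ℓ : (ℕ →₀ ℕ) → ℝ) (A : ℝ) (s : ℂ) : ℂ :=
  A * s + s * (s - 1) * lap ℓ A s

theorem zetaReg_eq (ℓ : (ℕ →₀ ℕ) → ℝ) (A : ℝ) {s : ℂ} (hs : s ≠ 1) :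
    zetaReg ℓ A s = (s - 1) * zetaCont ℓ A s := by
  have : s - 1 ≠ 0 := sub_ne_zero.2 hs
  unfold zetaReg zetaCont
  field_simp

variable {ℓ : (ℕ →₀ ℕ) → ℝ} {θ A C : ℝ} (H : LogSystem ℓ θ A C)
include H

theorem differentiableAt_zetaReg {s : ℂ} (hs : θ < s.re) :
    DifferentiableAt ℂ (zetaReg ℓ A) s := by
  have := H.differentiableAt_lap hs
  unfold zetaReg
  fun_prop

theorem norm_zetaReg_le {σ : ℝ} (hσ : θ < σ) {s : ℂ} (hs : σ ≤ s.re) :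
    ‖zetaReg ℓ A s‖ ≤ (A + C / (σ - θ)) * (1 + ‖s‖) ^ 2 := by
  have hA := H.A_pos
  have hC := H.C_nonneg
  have hσ' : 0 < σ - θ := sub_pos.2 hσ
  have h1 : ‖lap ℓ A s‖ ≤ C / (σ - θ) :=
    (H.norm_lap_le (hσ.trans_le hs)).trans (by gcongr)
  have h2 : ‖s - 1‖ ≤ ‖s‖ + 1 := (norm_sub_le _ _).trans (by simp)
  have hn := norm_nonneg s
  unfold zetaReg
  calc _ ≤ A * ‖s‖ + ‖s‖ * (‖s‖ + 1) * (C / (σ - θ)) := by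
        refine (norm_add_le _ _).trans ?_
        rw [norm_mul, norm_mul, norm_mul, Complex.norm_real, Real.norm_eq_abs, abs_of_pos hA]
        gcongr
    _ ≤ A * (1 + ‖s‖) ^ 2 + (1 + ‖s‖) ^ 2 * (C / (σ - θ)) := by
        gcongr <;> nlinarith
    _ = _ := by ring

theorem le_norm_zetaSeries {s : ℂ} (hs : 1 < s.re) :
    (s.re - 1) / ((A + C) * s.re) ≤ ‖zetaSeries ℓ s‖ := by
  have hA := H.A_pos
  have hC := H.C_nonneg
  have h1 := congrArg norm (H.zetaSeries_mul_moebius hs)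
  rw [norm_mul, norm_one] at h1
  have h2 : ‖∑' k, expMoebius k * cexp (-s * ℓ k)‖ ≤ (A + C) * s.re / (s.re - 1) := by
    refine (norm_tsum_le_tsum_norm (H.summable_norm_mul_cexp norm_expMoebius_le hs)).trans ?_
    refine le_trans (Summable.tsum_le_tsum (fun k => ?_)
      (H.summable_norm_mul_cexp norm_expMoebius_le hs) (H.summable_exp hs)) (H.tsum_exp_le hs)
    rw [norm_mul, norm_cexp_mul]
    exact mul_le_of_le_one_left (Real.exp_pos _).le (norm_expMoebius_le k)
  have hs0 : 0 < s.re := by linarith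
  have hs1 : 0 < s.re - 1 := by linarith
  rw [div_le_iff₀ (by positivity)]
  have h3 : 1 ≤ (A + C) * s.re / (s.re - 1) * ‖zetaSeries ℓ s‖ := by
    exact h1.symm.le.trans (mul_le_mul_of_nonneg_right h2 (norm_nonneg (zetaSeries ℓ s)))
  rw [div_mul_eq_mul_div, le_div_iff₀ hs1] at h3
  linarith

theorem zetaReg_ne_zero {s : ℂ} (hs : 1 < s.re) : zetaReg ℓ A s ≠ 0 := by
  have hs1 : s ≠ 1 := by rintro rfl; simp at hs
  rw [zetaReg_eq ℓ A hs1, H.zetaCont_eq hs]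
  refine mul_ne_zero (sub_ne_zero.2 hs1) fun h => ?_
  have := H.le_norm_zetaSeries hs
  rw [h, norm_zero] at this
  have hA := H.A_pos
  have hC := H.C_nonneg
  have : 0 < (s.re - 1) / ((A + C) * s.re) :=
    div_pos (by linarith) (mul_pos (by linarith) (by linarith))
  linarith

theorem local_card_zeros_le : ∃ D, 0 ≤ D ∧ ∀ (T : ℝ) (s : Finset ℂ), 2 ≤ T →
    (∀ z ∈ s, zetaReg ℓ A z = 0 ∧ (1 + θ) / 2 ≤ z.re ∧ |z.im| ≤ T) →
    ∀ τ, ((s.filter fun z => |z.im - τ| ≤ 1).card : ℝ) ≤ D * Real.log T := by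
  have hA := H.A_pos
  have hC := H.C_nonneg
  have hθ0 := H.theta_nonneg
  have hθ1 := H.theta_lt_one
  obtain ⟨η, hη⟩ : ∃ η, η = (1 - θ) / 4 := ⟨_, rfl⟩
  have hη0 : 0 < η := by rw [hη]; linarith
  obtain ⟨σ₁, hσ₁⟩ : ∃ σ₁, σ₁ = 2 + 1 / η := ⟨_, rfl⟩
  have hσ₁2 : 2 < σ₁ := by rw [hσ₁]; linarith [one_div_pos.2 hη0]
  obtain ⟨σ₂, hσ₂⟩ : ∃ σ₂, σ₂ = θ + η := ⟨_, rfl⟩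
  obtain ⟨R, hR⟩ : ∃ R, R = σ₁ - σ₂ := ⟨_, rfl⟩
  obtain ⟨r, hr⟩ : ∃ r, r = √((σ₁ - (1 + θ) / 2) ^ 2 + 1) := ⟨_, rfl⟩
  have hr0 : 0 < r := hr ▸ Real.sqrt_pos.2 (by positivity)
  have hη1 : 1 / η * η = 1 := by field_simp
  have hσ₂1 : σ₂ < 1 := by rw [hσ₂, hη]; linarith
  have hrR : r < R := by
    rw [hr, Real.sqrt_lt' (by rw [hR]; linarith)]
    have e : (1 + θ) / 2 = σ₂ + η := by rw [hσ₂, hη]; ring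
    rw [e, hR]
    have : 1 < η * (2 * σ₁ - 2 * σ₂ - η) := by
      have h1 : η * (2 * σ₁ - 2) = 2 * η + 2 := by rw [hσ₁]; linear_combination 2 * hη1
      have h2 : 2 * η * σ₂ + η * η < 2 * η + 1 := by nlinarith
      nlinarith
    nlinarith
  have hlog : 0 < Real.log (R / r) := Real.log_pos ((one_lt_div hr0).2 hrR)
  obtain ⟨K, hK⟩ : ∃ K, K = A + C / η := ⟨_, rfl⟩
  have hK0 : 0 < K := by rw [hK]; positivity
  obtain ⟨m, hm⟩ : ∃ m, m = (σ₁ - 1) * ((σ₁ - 1) / ((A + C) * σ₁)) := ⟨_, rfl⟩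
  have hm0 : 0 < m := by
    have : 0 < σ₁ - 1 := by linarith
    rw [hm]; positivity
  obtain ⟨B', hB'⟩ : ∃ B', B' = max 1 ((1 + K) * (4 + 2 * σ₁) ^ 2 / m) := ⟨_, rfl⟩
  have hB1 : 1 ≤ B' := hB' ▸ le_max_left _ _
  have hlogB : 0 ≤ Real.log B' := Real.log_nonneg hB1
  have hlog2 : 0 < Real.log 2 := Real.log_pos (by norm_num)
  refine ⟨(Real.log B' / Real.log 2 + 2) / Real.log (R / r), by positivity,
    fun T s hT hs τ => ?_⟩
  have hlogT : Real.log 2 ≤ Real.log T := Real.log_le_log (by norm_num) hT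
  have hlogT0 : 0 < Real.log T := by linarith
  by_cases hτ : |τ| ≤ T + 1
  swap
  · have : (s.filter fun z => |z.im - τ| ≤ 1) = ∅ := by
      refine Finset.filter_eq_empty_iff.2 fun z hz h => hτ ?_
      have h1 := (hs z hz).2.2
      have h2 : |τ| ≤ |z.im| + |z.im - τ| := by
        have := abs_sub z.im (z.im - τ)
        simpa using this
      linarith
    rw [this]
    simp
    positivity
  obtain ⟨c, hc⟩ : ∃ c : ℂ, c = σ₁ + τ * I := ⟨_, rfl⟩
  have hcre : c.re = σ₁ := by simp [hc]
  have hcim : c.im = τ := by simp [hc]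
  have hcn : ‖c‖ ≤ σ₁ + T + 1 := by
    have := Complex.norm_le_abs_re_add_abs_im c
    rw [hcre, hcim, abs_of_pos (by linarith)] at this
    linarith
  have hball : ∀ z ∈ Metric.closedBall c R, σ₂ ≤ z.re := by
    intro z hz
    have h1 := (Complex.abs_re_le_norm (z - c)).trans (mem_closedBall_iff_norm.1 hz)
    rw [sub_re, hcre] at h1
    have := (abs_le.1 h1).1
    rw [hR] at this
    linarith
  have hσ₂θ : θ < σ₂ := by rw [hσ₂]; linarith
  have hopen : IsOpen {z : ℂ | θ < z.re} := isOpen_lt continuous_const Complex.continuous_re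
  have han : AnalyticOnNhd ℂ (zetaReg ℓ A) (Metric.closedBall c R) := by
    have h1 : DifferentiableOn ℂ (zetaReg ℓ A) {z : ℂ | θ < z.re} := fun z hz =>
      (H.differentiableAt_zetaReg hz).differentiableWithinAt
    exact (h1.analyticOnNhd hopen).mono fun z hz => hσ₂θ.trans_le (hball z hz)
  obtain ⟨M, hM⟩ : ∃ M, M = (1 + K) * ((4 + 2 * σ₁) * T) ^ 2 := ⟨_, rfl⟩
  have hM1 : 1 ≤ M := by
    have : 1 ≤ ((4 + 2 * σ₁) * T) ^ 2 := one_le_pow₀ (one_le_mul_of_one_le_of_one_le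
      (by linarith) (by linarith))
    rw [hM]
    exact one_le_mul_of_one_le_of_one_le (by linarith) this
  have hbd : ∀ z ∈ Metric.sphere c R, ‖zetaReg ℓ A z‖ ≤ M := by
    intro z hz
    have h1 := H.norm_zetaReg_le hσ₂θ (hball z (Metric.sphere_subset_closedBall hz))
    have h2 : ‖z‖ ≤ ‖c‖ + R := by
      have h3 : ‖z - c‖ = R := mem_sphere_iff_norm.1 hz
      have h4 := norm_add_le c (z - c)
      rw [add_sub_cancel] at h4
      linarith
    have h5 : 1 + ‖z‖ ≤ (4 + 2 * σ₁) * T := by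
      have h6 : R ≤ σ₁ := by rw [hR, hσ₂]; linarith
      have h7 : 2 * (2 + 2 * σ₁) ≤ (2 + 2 * σ₁) * T := by
        rw [mul_comm]; exact mul_le_mul_of_nonneg_left hT (by linarith)
      linarith
    rw [show σ₂ - θ = η by rw [hσ₂]; ring] at h1
    refine h1.trans ?_
    rw [hM, ← hK]
    exact mul_le_mul (by linarith) (pow_le_pow_left₀ (by positivity) h5 2) (by positivity)
      (by linarith)
  have hfc : m ≤ ‖zetaReg ℓ A c‖ := by
    have hc1 : c ≠ 1 := fun h => by
      rw [h] at hcre; simp at hcre; linarith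
    have hcre' : 1 < c.re := by rw [hcre]; linarith
    rw [zetaReg_eq ℓ A hc1, H.zetaCont_eq hcre', norm_mul]
    have h1 := H.le_norm_zetaSeries hcre'
    have h2 : σ₁ - 1 ≤ ‖c - 1‖ := by
      have := Complex.re_le_norm (c - 1)
      simpa [hcre] using this
    rw [hcre] at h1
    have : 0 < σ₁ - 1 := by linarith
    rw [hm]
    gcongr
  have hcard := card_zeros_le hr0 hrR hM1 han
    (norm_pos_iff.1 (hm0.trans_le hfc)) hbd (s.filter fun z => |z.im - τ| ≤ 1) ?_
  · refine hcard.trans ?_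
    rw [div_mul_eq_mul_div]
    gcongr
    have h1 : M / ‖zetaReg ℓ A c‖ ≤ B' * T ^ 2 := by
      calc M / ‖zetaReg ℓ A c‖ ≤ M / m := by gcongr
        _ = (1 + K) * (4 + 2 * σ₁) ^ 2 / m * T ^ 2 := by rw [hM]; ring
        _ ≤ _ := by gcongr; rw [hB']; exact le_max_right _ _
    have h2 : 0 < M / ‖zetaReg ℓ A c‖ := div_pos (by linarith) (hm0.trans_le hfc)
    refine (Real.log_le_log h2 h1).trans ?_
    rw [Real.log_mul (by positivity) (by positivity), Real.log_pow, add_mul]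
    gcongr
    · rw [div_mul_eq_mul_div, le_div_iff₀ hlog2]
      gcongr
    · norm_num
  · intro z hz
    rw [Finset.mem_filter] at hz
    obtain ⟨hz, hzτ⟩ := hz
    have h0 := hs z hz
    refine ⟨?_, h0.1⟩
    have hre1 : z.re ≤ 1 := by
      by_contra! h
      exact H.zetaReg_ne_zero h h0.1
    rw [mem_closedBall_iff_norm, hr]
    apply Real.le_sqrt_of_sq_le
    rw [← Complex.normSq_eq_norm_sq, Complex.normSq_apply, sub_re, sub_im, hcre, hcim]
    have h3 : (z.im - τ) * (z.im - τ) ≤ 1 := by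
      have := (sq_le_one_iff_abs_le_one _).2 hzτ
      nlinarith
    have h4 : (z.re - σ₁) * (z.re - σ₁) ≤ (σ₁ - (1 + θ) / 2) ^ 2 := by
      rw [← pow_two, sq_le_sq, abs_of_nonpos (by linarith), abs_of_pos (by linarith)]
      linarith [h0.2.1]
    linarith

end LogSystem

theorem norm_cexp_sq_add_mul_sub (z ρ : ℂ) (V : ℝ) :
    ‖Complex.exp ((z - ρ) ^ 2 + V * (z - ρ))‖ =
      Real.exp ((z.re - ρ.re) ^ 2 - (z.im - ρ.im) ^ 2 + V * (z.re - ρ.re)) := by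
  rw [Complex.norm_exp]
  congr 1
  simp [pow_two]

open MeasureTheory Complex in
/-- A Gaussian-weighted Cauchy bound for the value of a holomorphic function inside a rectangle. -/
theorem norm_le_of_rect {h : ℂ → ℂ} {a b T V M η : ℝ} {ρ : ℂ}
    (hdiff : ∀ z : ℂ, a ≤ z.re → DifferentiableAt ℂ h z) (hη : 0 < η) (ha : a + η ≤ ρ.re)
    (hb : ρ.re + η ≤ b) (hba : b - a ≤ 2) (hT : 1 ≤ T) (him : |ρ.im| ≤ T) (hV : 0 ≤ V)
    (hM : ∀ z : ℂ, a ≤ z.re → z.re ≤ b → |z.im| = 2 * T → ‖h z‖ ≤ M) :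
    2 * Real.pi * ‖h ρ‖ ≤ Real.exp 4 / η *
      (Real.exp (-(V * (ρ.re - a))) *
          ∫ t in -(2 * T)..2 * T, ‖h (a + t * I)‖ * Real.exp (-(t - ρ.im) ^ 2)) +
      Real.exp 4 / η * (Real.exp (V * (b - ρ.re)) *
          ∫ t in -(2 * T)..2 * T, ‖h (b + t * I)‖ * Real.exp (-(t - ρ.im) ^ 2)) +
      4 * M * Real.exp (4 - T ^ 2 + 2 * V) := by
  have hab : a ≤ b := by linarith
  have him' := abs_le.1 him
  obtain ⟨g, hg⟩ : ∃ g : ℂ → ℂ, g = fun z => h z * cexp ((z - ρ) ^ 2 + V * (z - ρ)) := ⟨_, rfl⟩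
  have hgd : ∀ z : ℂ, a ≤ z.re → DifferentiableAt ℂ g z := by
    intro z hz
    have := hdiff z hz
    rw [hg]
    fun_prop
  have hgn : ∀ z, ‖g z‖ = ‖h z‖ *
      Real.exp ((z.re - ρ.re) ^ 2 - (z.im - ρ.im) ^ 2 + V * (z.re - ρ.re)) := by
    intro z
    rw [hg, norm_mul, norm_cexp_sq_add_mul_sub]
  have hgρ : g ρ = h ρ := by simp [hg]
  have key := integral_boundary_rect_div_sub (g := g) (a := a) (b := b) (c := -(2 * T))
    (d := 2 * T) (ρ := ρ) (by linarith) (by linarith) (by linarith) (by linarith) hgd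
  have vert : ∀ x : ℝ, a ≤ x → |x - ρ.re| ≤ 2 → η ≤ |x - ρ.re| →
      ‖∫ t in -(2 * T)..2 * T, g (x + t * I) / ((x : ℂ) + t * I - ρ)‖ ≤
      Real.exp 4 / η * (Real.exp (V * (x - ρ.re)) *
        ∫ t in -(2 * T)..2 * T, ‖h (x + t * I)‖ * Real.exp (-(t - ρ.im) ^ 2)) := by
    intro x hx hx2 hxη
    have hcont : Continuous fun t : ℝ => h (x + t * I) := by
      rw [continuous_iff_continuousAt]
      intro t
      have h1 : ContinuousAt h (x + t * I) := (hdiff _ (by simpa using hx)).continuousAt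
      exact ContinuousAt.comp (f := fun t : ℝ => (x + t * I : ℂ)) h1
        (by fun_prop : Continuous fun t : ℝ => (x + t * I : ℂ)).continuousAt
    rw [← mul_assoc, ← intervalIntegral.integral_const_mul]
    refine intervalIntegral.norm_integral_le_of_norm_le (by linarith)
      (Filter.Eventually.of_forall fun t _ => ?_) (Continuous.intervalIntegrable
        (continuous_const.mul (hcont.norm.mul (by fun_prop))) _ _)
    rw [norm_div, hgn]
    have h1 : η ≤ ‖(x : ℂ) + t * I - ρ‖ := by
      refine hxη.trans ?_
      have := Complex.abs_re_le_norm ((x : ℂ) + t * I - ρ)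
      simpa using this
    have h2 : ((x : ℂ) + t * I).re = x := by simp
    have h3 : ((x : ℂ) + t * I).im = t := by simp
    rw [h2, h3]
    have h4 : (x - ρ.re) ^ 2 ≤ 4 := by
      have := sq_le_sq' (by linarith [(abs_le.1 hx2).1] : -2 ≤ x - ρ.re) (abs_le.1 hx2).2
      linarith
    have h5 : Real.exp ((x - ρ.re) ^ 2 - (t - ρ.im) ^ 2 + V * (x - ρ.re)) ≤
        Real.exp 4 * Real.exp (V * (x - ρ.re)) * Real.exp (-(t - ρ.im) ^ 2) := by
      rw [← Real.exp_add, ← Real.exp_add]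
      apply Real.exp_le_exp.2
      linarith
    calc _ ≤ ‖h (x + t * I)‖ * (Real.exp 4 * Real.exp (V * (x - ρ.re)) *
          Real.exp (-(t - ρ.im) ^ 2)) / η := by gcongr
      _ = _ := by ring
  have horiz : ∀ y : ℝ, |y| = 2 * T →
      ‖∫ x in a..b, g (x + y * I) / ((x : ℂ) + y * I - ρ)‖ ≤
        2 * M * Real.exp (4 - T ^ 2 + 2 * V) := by
    intro y hy
    have hM0 : 0 ≤ M := (norm_nonneg _).trans (hM (a + y * I) (by simp) (by simpa) (by simpa))
    have hdist : T ≤ |y - ρ.im| := by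
      have := abs_sub_abs_le_abs_sub y ρ.im
      linarith
    refine (intervalIntegral.norm_integral_le_of_norm_le_const (C := M *
      Real.exp (4 - T ^ 2 + 2 * V)) fun x hx => ?_).trans ?_
    · rw [Set.uIoc_of_le hab] at hx
      rw [norm_div, hgn]
      have h2 : ((x : ℂ) + y * I).re = x := by simp
      have h3 : ((x : ℂ) + y * I).im = y := by simp
      rw [h2, h3]
      have h1 : 1 ≤ ‖(x : ℂ) + y * I - ρ‖ := by
        refine (hT.trans hdist).trans ?_
        have := Complex.abs_im_le_norm ((x : ℂ) + y * I - ρ)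
        simpa using this
      have h4 : (x - ρ.re) ^ 2 ≤ 2 ^ 2 := sq_le_sq' (by linarith [hx.1]) (by linarith [hx.2])
      have h5 : T ^ 2 ≤ (y - ρ.im) ^ 2 := sq_le_sq.2 (by rwa [abs_of_nonneg (by linarith)])
      have h6 : V * (x - ρ.re) ≤ V * 2 := mul_le_mul_of_nonneg_left (by linarith [hx.2]) hV
      have h7 := hM (x + y * I) (by simpa using hx.1.le) (by simpa using hx.2) (by simpa)
      refine (div_le_self (by positivity) h1).trans ?_
      refine mul_le_mul h7 (Real.exp_le_exp.2 ?_) (Real.exp_pos _).le hM0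
      linarith
    · rw [abs_of_nonneg (by linarith)]
      have : 0 ≤ M * Real.exp (4 - T ^ 2 + 2 * V) := by positivity
      nlinarith
  have h1 := horiz (-(2 * T)) (by rw [abs_neg, abs_of_nonneg (by linarith)])
  have h2 := horiz (2 * T) (abs_of_nonneg (by linarith))
  have h3 := vert b hab (by rw [abs_of_nonneg (by linarith)]; linarith)
    (by rw [abs_of_nonneg (by linarith)]; linarith)
  have h4 := vert a le_rfl (by rw [abs_of_nonpos (by linarith)]; linarith)
    (by rw [abs_of_nonpos (by linarith)]; linarith)
  rw [show V * (a - ρ.re) = -(V * (ρ.re - a)) by ring] at h4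
  have h5 : 2 * Real.pi * ‖h ρ‖ = ‖(2 * Real.pi * I * g ρ : ℂ)‖ := by
    rw [norm_mul, norm_mul, norm_mul, hgρ, Complex.norm_I, Complex.norm_real, Real.norm_eq_abs,
      abs_of_pos Real.pi_pos]
    simp
  rw [h5, ← key]
  refine (norm_sub_le _ _).trans ?_
  have h6 := norm_sub_le (∫ x in a..b, g (x + (-(2 * T) : ℝ) * I) /
    ((x : ℂ) + (-(2 * T) : ℝ) * I - ρ)) (∫ x in a..b, g (x + (2 * T : ℝ) * I) /
    ((x : ℂ) + (2 * T : ℝ) * I - ρ))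
  refine (add_le_add_left (norm_add_le _ _) _).trans ?_
  rw [norm_mul, norm_mul, Complex.norm_I, one_mul, one_mul]
  linarith

open MeasureTheory Complex in
theorem card_le_of_detect {h : ℂ → ℂ} {a b T V M η α G : ℝ} (s : Finset ℂ)
    (hdiff : ∀ z : ℂ, a ≤ z.re → DifferentiableAt ℂ h z) (hη : 0 < η) (ha : a + η ≤ α)
    (hb : 1 + η ≤ b) (hα : α ≤ 1) (hba : b - a ≤ 2) (hT : 1 ≤ T) (hV : 0 ≤ V)
    (hM : ∀ z : ℂ, a ≤ z.re → z.re ≤ b → |z.im| = 2 * T → ‖h z‖ ≤ M)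
    (hs : ∀ ρ ∈ s, α ≤ ρ.re ∧ ρ.re ≤ 1 ∧ |ρ.im| ≤ T ∧ 1 / 3 ≤ ‖h ρ‖)
    (hG : ∀ t : ℝ, ∑ ρ ∈ s, Real.exp (-(t - ρ.im) ^ 2) ≤ G)
    (hsmall : 4 * M * Real.exp (4 - T ^ 2 + 2 * V) ≤ 1 / 2) :
    (s.card : ℝ) / 2 ≤ Real.exp 4 / η * G *
      (Real.exp (-(V * (α - a))) * (∫ t in -(2 * T)..2 * T, ‖h (a + t * I)‖) +
        Real.exp 4 / (2 * η) * Real.exp (2 * (V * (b - α))) *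
          ∫ t in -(2 * T)..2 * T, ‖h (b + t * I)‖ ^ 2) := by
  have hcont : ∀ x : ℝ, a ≤ x → Continuous fun t : ℝ => h (x + t * I) := by
    intro x hx
    rw [continuous_iff_continuousAt]
    intro t
    have h1 : ContinuousAt h (x + t * I) := (hdiff _ (by simpa using hx)).continuousAt
    exact ContinuousAt.comp (f := fun t : ℝ => (x + t * I : ℂ)) h1
      (by fun_prop : Continuous fun t : ℝ => (x + t * I : ℂ)).continuousAt
  have hTT : -(2 * T) ≤ 2 * T := by linarith
  have hsumG : ∀ f : ℝ → ℝ, Continuous f → (∀ t, 0 ≤ f t) →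
      ∑ ρ ∈ s, ∫ t in -(2 * T)..2 * T, f t * Real.exp (-(t - ρ.im) ^ 2) ≤
        G * ∫ t in -(2 * T)..2 * T, f t := by
    intro f hf hf0
    rw [← intervalIntegral.integral_finsetSum fun ρ _ =>
      Continuous.intervalIntegrable (by fun_prop) _ _, ← intervalIntegral.integral_const_mul]
    refine intervalIntegral.integral_mono_on hTT
      (Continuous.intervalIntegrable (by fun_prop) _ _)
      (Continuous.intervalIntegrable (by fun_prop) _ _) fun t _ => ?_
    rw [← Finset.mul_sum, mul_comm G]
    exact mul_le_mul_of_nonneg_left (hG t) (hf0 t)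
  have hab : a ≤ b := by linarith
  have ha' := hcont a le_rfl
  have hb' := hcont b hab
  have hgauss : ∀ γ : ℝ, ∫ t in -(2 * T)..2 * T, Real.exp (-(t - γ) ^ 2) ≤ 2 := by
    intro γ
    have hint : Integrable fun t : ℝ => Real.exp (-(t - γ) ^ 2) := by
      have := (integrable_exp_neg_mul_sq (by norm_num : (0 : ℝ) < 1)).comp_sub_right γ
      simpa using this
    rw [intervalIntegral.integral_of_le hTT]
    refine (setIntegral_le_integral hint (Eventually.of_forall fun t => (Real.exp_pos _).le)).trans ?_
    rw [integral_sub_right_eq_self (fun t : ℝ => Real.exp (-t ^ 2))]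
    have := integral_gaussian 1
    simp only [neg_mul, one_mul, div_one] at this
    rw [this, Real.sqrt_le_left (by norm_num)]
    linarith [Real.pi_le_four]
  have hpt : ∀ ρ ∈ s, (1 : ℝ) / 2 ≤ Real.exp 4 / η * (Real.exp (-(V * (α - a))) *
          ∫ t in -(2 * T)..2 * T, ‖h (a + t * I)‖ * Real.exp (-(t - ρ.im) ^ 2)) +
      Real.exp 4 / η * (Real.exp 4 / (2 * η) * Real.exp (2 * (V * (b - α))) *
          ∫ t in -(2 * T)..2 * T, ‖h (b + t * I)‖ ^ 2 * Real.exp (-(t - ρ.im) ^ 2)) := by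
    intro ρ hρ
    obtain ⟨h1, h2, h3, h4⟩ := hs ρ hρ
    have key := norm_le_of_rect hdiff hη (ha.trans h1) (by linarith : ρ.re + η ≤ b) hba hT h3 hV hM
    have hpi : 2 ≤ 2 * Real.pi * ‖h ρ‖ := by nlinarith [Real.pi_gt_three]
    have hI0 : 0 ≤ ∫ t in -(2 * T)..2 * T, ‖h (a + t * I)‖ * Real.exp (-(t - ρ.im) ^ 2) :=
      intervalIntegral.integral_nonneg hTT fun t _ => by positivity
    have hJ0 : 0 ≤ ∫ t in -(2 * T)..2 * T, ‖h (b + t * I)‖ * Real.exp (-(t - ρ.im) ^ 2) :=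
      intervalIntegral.integral_nonneg hTT fun t _ => by positivity
    have e1 : Real.exp (-(V * (ρ.re - a))) ≤ Real.exp (-(V * (α - a))) :=
      Real.exp_le_exp.2 (by nlinarith)
    have e2 : Real.exp (V * (b - ρ.re)) ≤ Real.exp (V * (b - α)) :=
      Real.exp_le_exp.2 (by nlinarith)
    have hright : Real.exp (V * (b - α)) *
        ∫ t in -(2 * T)..2 * T, ‖h (b + t * I)‖ * Real.exp (-(t - ρ.im) ^ 2) ≤
        η / Real.exp 4 + Real.exp 4 / (2 * η) * Real.exp (2 * (V * (b - α))) *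
          ∫ t in -(2 * T)..2 * T, ‖h (b + t * I)‖ ^ 2 * Real.exp (-(t - ρ.im) ^ 2) := by
      have h5 : η / (2 * Real.exp 4) * (∫ t in -(2 * T)..2 * T, Real.exp (-(t - ρ.im) ^ 2)) ≤
          η / Real.exp 4 := by
        calc _ ≤ η / (2 * Real.exp 4) * 2 := by gcongr; exact hgauss _
          _ = _ := by field_simp
      refine le_trans ?_ (add_le_add_left h5 _)
      have hgc : Continuous fun t : ℝ => η / (2 * Real.exp 4) * Real.exp (-(t - ρ.im) ^ 2) := by
        fun_prop
      have hsq : Continuous fun t : ℝ => Real.exp 4 / (2 * η) * Real.exp (2 * (V * (b - α))) *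
          (‖h (b + t * I)‖ ^ 2 * Real.exp (-(t - ρ.im) ^ 2)) :=
        continuous_const.mul ((hb'.norm.pow 2).mul (by fun_prop))
      rw [← intervalIntegral.integral_const_mul, ← intervalIntegral.integral_const_mul,
        ← intervalIntegral.integral_const_mul, ← intervalIntegral.integral_add
          (Continuous.intervalIntegrable hgc _ _) (Continuous.intervalIntegrable hsq _ _)]
      refine intervalIntegral.integral_mono_on hTT
        (Continuous.intervalIntegrable (continuous_const.mul (hb'.norm.mul (by fun_prop))) _ _)
        (Continuous.intervalIntegrable (hgc.add hsq) _ _) fun t _ => ?_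
      rw [← mul_assoc, ← mul_assoc, ← add_mul]
      refine mul_le_mul_of_nonneg_right ?_ (Real.exp_pos _).le
      rw [show 2 * (V * (b - α)) = V * (b - α) + V * (b - α) by ring, Real.exp_add]
      generalize Real.exp (V * (b - α)) = u
      generalize ‖h (b + t * I)‖ = v
      have h6 : η / (2 * Real.exp 4) + Real.exp 4 / (2 * η) * (u * u) * v ^ 2 - u * v =
          (η - Real.exp 4 * (u * v)) ^ 2 / (2 * Real.exp 4 * η) := by
        field_simp
        ring
      have h7 : 0 ≤ (η - Real.exp 4 * (u * v)) ^ 2 / (2 * Real.exp 4 * η) := by positivity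
      linarith
    have f1 : Real.exp 4 / η * (Real.exp (-(V * (ρ.re - a))) *
        ∫ t in -(2 * T)..2 * T, ‖h (a + t * I)‖ * Real.exp (-(t - ρ.im) ^ 2)) ≤
        Real.exp 4 / η * (Real.exp (-(V * (α - a))) *
        ∫ t in -(2 * T)..2 * T, ‖h (a + t * I)‖ * Real.exp (-(t - ρ.im) ^ 2)) := by gcongr
    have f2 : Real.exp 4 / η * (Real.exp (V * (b - ρ.re)) *
        ∫ t in -(2 * T)..2 * T, ‖h (b + t * I)‖ * Real.exp (-(t - ρ.im) ^ 2)) ≤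
        Real.exp 4 / η * (η / Real.exp 4 + Real.exp 4 / (2 * η) * Real.exp (2 * (V * (b - α))) *
          ∫ t in -(2 * T)..2 * T, ‖h (b + t * I)‖ ^ 2 * Real.exp (-(t - ρ.im) ^ 2)) :=
      mul_le_mul_of_nonneg_left ((mul_le_mul_of_nonneg_right e2 hJ0).trans hright) (by positivity)
    rw [mul_add, show Real.exp 4 / η * (η / Real.exp 4) = 1 by field_simp] at f2
    linarith
  have hsum := Finset.sum_le_sum hpt
  rw [Finset.sum_const, nsmul_eq_mul, Finset.sum_add_distrib, ← Finset.mul_sum, ← Finset.mul_sum,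
    ← Finset.mul_sum, ← Finset.mul_sum] at hsum
  have g1 := hsumG (fun t => ‖h (a + t * I)‖) ha'.norm fun t => norm_nonneg _
  have g2 := hsumG (fun t => ‖h (b + t * I)‖ ^ 2) (hb'.norm.pow 2) fun t => by positivity
  calc (s.card : ℝ) / 2 = s.card * (1 / 2) := by ring
    _ ≤ _ := hsum
    _ ≤ Real.exp 4 / η * (Real.exp (-(V * (α - a))) *
          (G * ∫ t in -(2 * T)..2 * T, ‖h (a + t * I)‖)) +
      Real.exp 4 / η * (Real.exp 4 / (2 * η) * Real.exp (2 * (V * (b - α))) *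
          (G * ∫ t in -(2 * T)..2 * T, ‖h (b + t * I)‖ ^ 2)) := by gcongr
    _ = _ := by ring

theorem norm_sub_one_le_norm_add_one {s : ℂ} (hs : 0 ≤ s.re) : ‖s - 1‖ ≤ ‖s + 1‖ := by
  rw [← sq_le_sq₀ (norm_nonneg _) (norm_nonneg _), ← Complex.normSq_eq_norm_sq,
    ← Complex.normSq_eq_norm_sq, Complex.normSq_apply, Complex.normSq_apply]
  simp
  nlinarith

theorem one_le_norm_add_one {s : ℂ} (hs : 0 ≤ s.re) : 1 ≤ ‖s + 1‖ := by
  have := Complex.re_le_norm (s + 1)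
  simp at this
  linarith

namespace LogSystem

open MeasureTheory Complex Real

/-- The zero detector: `(s - 1) / (s + 1)` times `ζ * mol - 1`. -/
noncomputable def detector (ℓ : (ℕ →₀ ℕ) → ℝ) (A L : ℝ) (s : ℂ) : ℂ :=
  (zetaReg ℓ A s * mol ℓ L s - (s - 1)) / (s + 1)

theorem detector_eq (ℓ : (ℕ →₀ ℕ) → ℝ) (A L : ℝ) {s : ℂ} (hs : s ≠ 1) :
    detector ℓ A L s = (s - 1) / (s + 1) * (zetaCont ℓ A s * mol ℓ L s - 1) := by
  rw [detector, zetaReg_eq ℓ A hs]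
  ring

theorem norm_detector_le_norm (ℓ : (ℕ →₀ ℕ) → ℝ) (A L : ℝ) {s : ℂ} (hs : s ≠ 1) (hs0 : 0 ≤ s.re) :
    ‖detector ℓ A L s‖ ≤ ‖zetaCont ℓ A s * mol ℓ L s - 1‖ := by
  rw [detector_eq ℓ A L hs, norm_mul, norm_div]
  exact mul_le_of_le_one_left (norm_nonneg _)
    (div_le_one_of_le₀ (norm_sub_one_le_norm_add_one hs0) (norm_nonneg _))

theorem third_le_norm_detector (L : ℝ) {ℓ : (ℕ →₀ ℕ) → ℝ} {A : ℝ} {ρ : ℂ}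
    (hρ : zetaReg ℓ A ρ = 0) (h0 : 0 ≤ ρ.re) (h1 : ρ.re ≤ 1) (him : 1 ≤ |ρ.im|) :
    1 / 3 ≤ ‖detector ℓ A L ρ‖ := by
  have hp : 0 < ‖ρ + 1‖ := one_pos.trans_le (one_le_norm_add_one h0)
  rw [detector, hρ, zero_mul, zero_sub, norm_div, norm_neg, le_div_iff₀ hp]
  have h2 : ‖ρ + 1‖ ≤ 3 * ‖ρ - 1‖ := by
    rw [← sq_le_sq₀ (norm_nonneg _) (by positivity), mul_pow, ← Complex.normSq_eq_norm_sq,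
      ← Complex.normSq_eq_norm_sq, Complex.normSq_apply, Complex.normSq_apply]
    have : 1 ≤ ρ.im ^ 2 := by rw [← sq_abs]; exact one_le_pow₀ him
    simp
    nlinarith [sq_nonneg (ρ.re - 1)]
  linarith

variable {ℓ : (ℕ →₀ ℕ) → ℝ} {θ A C : ℝ} (H : LogSystem ℓ θ A C)
include H

theorem differentiable_mol (L : ℝ) : Differentiable ℂ (mol ℓ L) := by
  rw [show mol ℓ L = fun s => ∑ k ∈ (H.finite L).toFinset, expMoebius k * cexp (-s * ℓ k) from
    funext fun s => H.mol_eq_sum L s]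
  fun_prop

theorem norm_mol_le {L : ℝ} (hL : 0 ≤ L) {s : ℂ} (hs : 0 ≤ s.re) :
    ‖mol ℓ L s‖ ≤ (A + C) * rexp L := by
  refine le_trans ?_ (H.cnt_le hL)
  rw [H.mol_eq_sum, cnt, Set.ncard_eq_toFinset_card _ (H.finite L)]
  refine (norm_sum_le _ _).trans ?_
  rw [← nsmul_one, ← Finset.sum_const]
  refine Finset.sum_le_sum fun k _ => ?_
  rw [norm_mul, norm_cexp_mul]
  refine mul_le_one₀ (norm_expMoebius_le k) (Real.exp_pos _).le (Real.exp_le_one_iff.2 ?_)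
  have := mul_nonneg hs (H.nonneg k)
  linarith

theorem differentiableAt_detector (L : ℝ) {s : ℂ} (hs : θ < s.re) :
    DifferentiableAt ℂ (detector ℓ A L) s := by
  have h1 := H.differentiableAt_zetaReg hs
  have h2 := H.differentiable_mol L s
  have h3 : s + 1 ≠ 0 := norm_pos_iff.1
    (one_pos.trans_le (one_le_norm_add_one (H.theta_nonneg.trans hs.le)))
  unfold detector
  fun_prop (disch := exact h3)

theorem norm_detector_le {σ L : ℝ} (hσ : θ < σ) (hL : 0 ≤ L) {s : ℂ} (hs : σ ≤ s.re) :
    ‖detector ℓ A L s‖ ≤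
      (A + C / (σ - θ)) * (1 + ‖s‖) ^ 2 * ((A + C) * rexp L) + 1 := by
  have hs0 : 0 ≤ s.re := H.theta_nonneg.trans (hσ.le.trans hs)
  have h1 := one_le_norm_add_one hs0
  rw [detector, sub_div]
  refine (norm_sub_le _ _).trans (add_le_add ?_ ?_)
  · rw [norm_div]
    refine (div_le_self (norm_nonneg _) h1).trans ?_
    rw [norm_mul]
    exact mul_le_mul (H.norm_zetaReg_le hσ hs) (H.norm_mol_le hL hs0) (norm_nonneg _)
      ((norm_nonneg _).trans (H.norm_zetaReg_le hσ hs))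
  · rw [norm_div]
    exact div_le_one_of_le₀ (norm_sub_one_le_norm_add_one hs0) (norm_nonneg _)

theorem continuous_detector_line (L : ℝ) {σ : ℝ} (hσ : θ < σ) :
    Continuous fun t : ℝ => detector ℓ A L (σ + t * I) := by
  rw [continuous_iff_continuousAt]
  intro t
  have h1 : ContinuousAt (detector ℓ A L) (σ + t * I) :=
    (H.differentiableAt_detector L (by simpa using hσ)).continuousAt
  exact ContinuousAt.comp (f := fun t : ℝ => (σ + t * I : ℂ)) h1
    (by fun_prop : Continuous fun t : ℝ => (σ + t * I : ℂ)).continuousAt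

theorem continuous_mol_line (L σ : ℝ) : Continuous fun t : ℝ => mol ℓ L (σ + t * I) :=
  (H.differentiable_mol L).continuous.comp
    (by fun_prop : Continuous fun t : ℝ => (σ + t * I : ℂ))

theorem integral_norm_detector_le : ∃ D, 0 ≤ D ∧ ∀ L U : ℝ, 0 ≤ L → 1 ≤ U →
    rexp ((1 - θ) * L) = U →
    ∫ t in -U..U, ‖detector ℓ A L (((1 + θ) / 2 : ℝ) + t * I)‖ ≤ D * (U * (L + 2)) := by
  obtain ⟨D, hD0, hD⟩ := H.integral_norm_sq_zetaCont_le
  have hA := H.A_pos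
  have hC := H.C_nonneg
  have hθ0 := H.theta_nonneg
  have hθ1 := H.theta_lt_one
  obtain ⟨D', hD'⟩ : ∃ D', D' = 8 * π * rexp 2 * (A + 2 * C) * (2 * (rexp 1 * (A + C))) := ⟨_, rfl⟩
  have hD'0 : 0 ≤ D' := by rw [hD']; positivity
  refine ⟨1 + D + D', by positivity, fun L U hL hU hLU => ?_⟩
  have hz := hD L U hL hU hLU
  have hm := H.integral_norm_sq_mol_le hL hU hLU
  obtain ⟨a, ha⟩ : ∃ a, a = (1 + θ) / 2 := ⟨_, rfl⟩
  rw [← ha] at hz hm ⊢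
  have haθ : θ < a := by rw [ha]; linarith
  have ha1 : a < 1 := by rw [ha]; linarith
  have c1 := H.continuous_zetaCont_line haθ ha1.ne
  have c2 := H.continuous_mol_line L a
  have i1 : IntervalIntegrable (fun t : ℝ => ‖zetaCont ℓ A (a + t * I)‖ ^ 2) volume (-U) U :=
    (c1.norm.pow 2).intervalIntegrable _ _
  have i2 : IntervalIntegrable (fun t : ℝ => ‖mol ℓ L (a + t * I)‖ ^ 2) volume (-U) U :=
    (c2.norm.pow 2).intervalIntegrable _ _
  have hle : ∫ t in -U..U, ‖detector ℓ A L (a + t * I)‖ ≤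
      ∫ t in -U..U, (1 + (‖zetaCont ℓ A (a + t * I)‖ ^ 2 + ‖mol ℓ L (a + t * I)‖ ^ 2) / 2) := by
    refine intervalIntegral.integral_mono_on (by linarith)
      ((H.continuous_detector_line L haθ).norm.intervalIntegrable _ _)
      (intervalIntegrable_const.add ((i1.add i2).div_const 2)) fun t _ => ?_
    refine (norm_detector_le_norm ℓ A L (fun h => ?_) (by simp; linarith)).trans ?_
    · have := congrArg Complex.re h
      simp at this
      linarith
    · refine (norm_sub_le _ _).trans ?_
      rw [norm_mul, norm_one]
      nlinarith [sq_nonneg (‖zetaCont ℓ A (a + t * I)‖ - ‖mol ℓ L (a + t * I)‖)]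
  rw [intervalIntegral.integral_add intervalIntegrable_const ((i1.add i2).div_const 2),
    intervalIntegral.integral_div, intervalIntegral.integral_add i1 i2,
    intervalIntegral.integral_const, smul_eq_mul, mul_one] at hle
  have hm' : 8 * π * rexp 2 * (A + 2 * C) * (2 * U * (rexp 1 * ((A + C) * (L + 2)))) =
      D' * (U * (L + 2)) := by rw [hD']; ring
  rw [hm'] at hm
  have h1 : 0 ≤ D * (U * (L + 2)) := by positivity
  have h2 : 0 ≤ D' * (U * (L + 2)) := by positivity
  have h3 : 2 * U ≤ U * (L + 2) := by nlinarith
  linarith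

theorem integral_norm_sq_detector_le : ∃ D, 0 ≤ D ∧ ∀ L U η : ℝ, 0 ≤ L → 1 ≤ U →
    rexp ((1 - θ) * L) = U → 0 < η → η ≤ 1 →
    ∫ t in -U..U, ‖detector ℓ A L ((1 + η : ℝ) + t * I)‖ ^ 2 ≤ D * (1 / η) ^ 4 := by
  have hA := H.A_pos
  have hC := H.C_nonneg
  have hθ1 := H.theta_lt_one
  refine ⟨8 * π * rexp 2 * (A + 2 * C) * (2 * ((A + C) * 2) ^ 4), by positivity,
    fun L U η hL hU hLU hη hη1 => ?_⟩
  have h1 := H.integral_norm_sq_zeta_mul_mol_sub_one_le (σ := 1 + η) (L := L) (T := U) (B := 1)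
    (by linarith) hL hU (by
      rw [← hLU, ← Real.exp_add, ← Real.exp_zero]
      exact Real.exp_le_exp.2 (by linarith))
  have hσ : θ < 1 + η := by linarith
  have hre : ∀ t : ℝ, (((1 + η : ℝ) : ℂ) + t * I).re = 1 + η := fun t => by simp
  have hle : ∫ t in -U..U, ‖detector ℓ A L ((1 + η : ℝ) + t * I)‖ ^ 2 ≤
      ∫ t in -U..U, ‖zetaSeries ℓ ((1 + η : ℝ) + t * I) * mol ℓ L ((1 + η : ℝ) + t * I) - 1‖ ^ 2 := by
    have e : (fun t : ℝ => ‖zetaSeries ℓ ((1 + η : ℝ) + t * I) * mol ℓ L ((1 + η : ℝ) + t * I) - 1‖ ^ 2)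
        = fun t : ℝ => ‖zetaCont ℓ A ((1 + η : ℝ) + t * I) * mol ℓ L ((1 + η : ℝ) + t * I) - 1‖ ^ 2 := by
      funext t
      rw [H.zetaCont_eq (by rw [hre]; linarith)]
    rw [e]
    refine intervalIntegral.integral_mono_on (by linarith)
      (((H.continuous_detector_line L hσ).norm.pow 2).intervalIntegrable _ _)
      (Continuous.intervalIntegrable ((((H.continuous_zetaCont_line hσ (by linarith)).mul
        (H.continuous_mol_line L _)).sub continuous_const).norm.pow 2) _ _) fun t _ => ?_
    refine pow_le_pow_left₀ (norm_nonneg _) (norm_detector_le_norm ℓ A L (fun h => ?_) ?_) 2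
    · have := congrArg Complex.re h
      rw [hre] at this
      simp at this
      linarith
    · rw [hre]; linarith
  refine hle.trans (h1.trans ?_)
  have h2 : (A + C) * (2 * (1 + η) - 1) / (2 * (1 + η) - 2) ≤ (A + C) * 2 * (1 / η) := by
    rw [mul_one_div]
    rw [show 2 * (1 + η) - 2 = 2 * η by ring, div_le_div_iff₀ (by positivity) hη]
    have : 0 ≤ (A + C) * η := by positivity
    nlinarith
  have h3 : 0 ≤ (A + C) * (2 * (1 + η) - 1) / (2 * (1 + η) - 2) :=
    div_nonneg (mul_nonneg (by positivity) (by linarith)) (by linarith)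
  calc _ ≤ 8 * π * rexp 2 * (A + 2 * C) * ((1 + 1) * ((A + C) * 2 * (1 / η)) ^ 4) := by gcongr
    _ = _ := by ring

end LogSystem

theorem exists_threshold (K c q : ℝ) : ∃ T₀ : ℝ, ∀ T κ : ℝ, T₀ ≤ T → κ ≤ 2 * q →
    4 * (K * T ^ c) * Real.exp (4 - T ^ 2 + 2 * (κ * Real.log T)) ≤ 1 / 2 := by
  have h1 := (tendsto_rpow_mul_exp_neg_mul_atTop_nhds_zero (c + 4 * q) 1 one_pos).const_mul
    (4 * |K| * Real.exp 4)
  rw [mul_zero] at h1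
  have h2 := h1.eventually (ge_mem_nhds (by norm_num : (0 : ℝ) < 1 / 2))
  obtain ⟨T₀, hT₀⟩ := Filter.eventually_atTop.1 h2
  refine ⟨max T₀ 1, fun T κ hT hκ => ?_⟩
  have hT1 : 1 ≤ T := (le_max_right _ _).trans hT
  have hT0 : 0 < T := by linarith
  have h3 := hT₀ T ((le_max_left _ _).trans hT)
  refine le_trans ?_ h3
  have h4 : Real.exp (4 - T ^ 2 + 2 * (κ * Real.log T)) ≤
      Real.exp 4 * (T ^ (4 * q) * Real.exp (-1 * T)) := by
    rw [Real.rpow_def_of_pos hT0, ← Real.exp_add, ← Real.exp_add]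
    apply Real.exp_le_exp.2
    have := mul_le_mul_of_nonneg_right hκ (Real.log_nonneg hT1)
    nlinarith
  have h5 : 4 * (K * T ^ c) ≤ 4 * (|K| * T ^ c) := by
    have := mul_le_mul_of_nonneg_right (le_abs_self K) (Real.rpow_nonneg hT0.le c)
    linarith
  calc _ ≤ 4 * (|K| * T ^ c) * (Real.exp 4 * (T ^ (4 * q) * Real.exp (-1 * T))) := by
        gcongr
    _ = _ := by rw [Real.rpow_add hT0]; ring

namespace LogSystem

open MeasureTheory Complex Real

variable {ℓ : (ℕ →₀ ℕ) → ℝ} {θ A C : ℝ} (H : LogSystem ℓ θ A C)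
include H

theorem exists_detector_bound : ∃ K, ∀ (L T : ℝ) (z : ℂ), 2 ≤ T → L = Real.log (2 * T) / (1 - θ) →
    (1 + θ) / 2 ≤ z.re → z.re ≤ 2 → |z.im| = 2 * T →
    ‖detector ℓ A L z‖ ≤ K * T ^ (2 + 1 / (1 - θ)) := by
  have hA := H.A_pos
  have hC := H.C_nonneg
  have hθ0 := H.theta_nonneg
  have hθ1 := H.theta_lt_one
  have hθ1' : 0 < 1 - θ := by linarith
  obtain ⟨K, hK⟩ : ∃ K, K = A + C / ((1 + θ) / 2 - θ) := ⟨_, rfl⟩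
  have hK0 : 0 < K := by
    rw [hK, show (1 + θ) / 2 - θ = (1 - θ) / 2 by ring]
    positivity
  obtain ⟨q, hq⟩ : ∃ q, q = 1 / (1 - θ) := ⟨_, rfl⟩
  have hq0 : 0 < q := by rw [hq]; positivity
  refine ⟨K * 16 * ((A + C) * 2 ^ q) + 1, fun L T z hT hL hz hz2 him => ?_⟩
  rw [← hq]
  have hT0 : 0 < T := by linarith
  have hlog : 0 ≤ Real.log (2 * T) := Real.log_nonneg (by linarith)
  have hL0 : 0 ≤ L := by rw [hL]; positivity
  have h1 := H.norm_detector_le (σ := (1 + θ) / 2) (L := L) (by linarith) hL0 hz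
  rw [← hK] at h1
  have h2 : rexp L = 2 ^ q * T ^ q := by
    rw [← Real.mul_rpow (by norm_num) hT0.le, Real.rpow_def_of_pos (by linarith), hL, hq,
      mul_one_div]
  have h3 : 1 + ‖z‖ ≤ 4 * T := by
    have := Complex.norm_le_abs_re_add_abs_im z
    rw [him, abs_of_nonneg (by linarith)] at this
    linarith
  have h4 : 1 ≤ T ^ (2 + q) := Real.one_le_rpow (by linarith) (by linarith)
  calc _ ≤ _ := h1
    _ ≤ K * (4 * T) ^ 2 * ((A + C) * (2 ^ q * T ^ q)) + 1 := by rw [h2]; gcongr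
    _ = K * 16 * ((A + C) * 2 ^ q) * T ^ (2 + q) + 1 := by
      rw [Real.rpow_add hT0, Real.rpow_two]; ring
    _ ≤ _ := by linarith

theorem card_zeros_le_of_large : ∃ T₀ D, 3 ≤ T₀ ∧ 0 ≤ D ∧ ∀ (α T : ℝ) (s : Finset ℂ),
    (1 + θ) / 2 + 1 / Real.log T ≤ α → α ≤ 1 → T₀ ≤ T →
    (∀ z ∈ s, zetaReg ℓ A z = 0 ∧ α ≤ z.re ∧ |z.im| ≤ T ∧ 1 ≤ |z.im|) →
    (s.card : ℝ) ≤ D * T ^ (4 * (1 - α) / (3 - 2 * α - θ)) * Real.log T ^ 9 := by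
  have hθ0 := H.theta_nonneg
  have hθ1 := H.theta_lt_one
  have hθ1' : 0 < 1 - θ := by linarith
  obtain ⟨q, hq⟩ : ∃ q, q = 1 / (1 - θ) := ⟨_, rfl⟩
  have hq0 : 0 < q := by rw [hq]; positivity
  obtain ⟨K, hK⟩ := H.exists_detector_bound
  rw [← hq] at hK
  obtain ⟨T₀, hT₀⟩ := exists_threshold K (2 + q) q
  obtain ⟨D₁, hD₁0, hD₁⟩ := H.local_card_zeros_le
  obtain ⟨D₂, hD₂0, hD₂⟩ := H.integral_norm_detector_le
  obtain ⟨D₃, hD₃0, hD₃⟩ := H.integral_norm_sq_detector_le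
  obtain ⟨D₄, hD₄⟩ : ∃ D₄, D₄ = rexp 1 / 2 * √(2 * π) * D₁ := ⟨_, rfl⟩
  have hD₄0 : 0 ≤ D₄ := by rw [hD₄]; positivity
  obtain ⟨P, hP⟩ : ∃ P, P = 2 * D₂ * (2 * q + 2) := ⟨_, rfl⟩
  have hP0 : 0 ≤ P := by rw [hP]; positivity
  obtain ⟨Q, hQ⟩ : ∃ Q, Q = rexp 4 / 2 * rexp (4 * q) * D₃ := ⟨_, rfl⟩
  have hQ0 : 0 ≤ Q := by rw [hQ]; positivity
  refine ⟨max T₀ 3, 2 * (rexp 4 * D₄ * (P + Q)), le_max_right _ _, by positivity,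
    fun α T s hα hα1 hT hs => ?_⟩
  have hT₀T : T₀ ≤ T := (le_max_left _ _).trans hT
  have hT3 : 3 ≤ T := (le_max_right _ _).trans hT
  have hT0 : 0 < T := by linarith
  obtain ⟨l, hl⟩ : ∃ l, l = Real.log T := ⟨_, rfl⟩
  have hl1 : 1 ≤ l := by
    rw [hl, Real.le_log_iff_exp_le hT0]
    linarith [Real.exp_one_lt_d9]
  have hl0 : 0 < l := by linarith
  obtain ⟨η, hη⟩ : ∃ η, η = 1 / l := ⟨_, rfl⟩
  have hη0 : 0 < η := by rw [hη]; positivity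
  have hη1 : η ≤ 1 := by rw [hη]; exact div_le_one_of_le₀ hl1 hl0.le
  have hηl : l * η = 1 := by rw [hη]; field_simp
  have hη' : 1 / η = l := by rw [hη]; simp
  rw [← hl] at hα ⊢
  rw [← hη] at hα
  obtain ⟨d, hd⟩ : ∃ d, d = 3 - 2 * α - θ := ⟨_, rfl⟩
  have hdθ : 1 - θ ≤ d := by linarith
  have hd0 : 0 < d := by linarith
  obtain ⟨κ, hκ⟩ : ∃ κ, κ = 2 / d := ⟨_, rfl⟩
  have hκ0 : 0 < κ := by rw [hκ]; positivity
  have hκq : κ ≤ 2 * q := by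
    rw [hκ, hq, mul_one_div]
    gcongr
  obtain ⟨E, hE⟩ : ∃ E, E = 4 * (1 - α) / d := ⟨_, rfl⟩
  rw [← hd, ← hE]
  have hTE : T ^ E = rexp (E * l) := by rw [Real.rpow_def_of_pos hT0, ← hl, mul_comm]
  obtain ⟨L, hL⟩ : ∃ L, L = Real.log (2 * T) / (1 - θ) := ⟨_, rfl⟩
  have hlog2T : Real.log (2 * T) = Real.log 2 + l := by
    rw [Real.log_mul (by norm_num) hT0.ne', hl]
  have hL0 : 0 ≤ L := by rw [hL, hlog2T]; have := Real.log_nonneg one_le_two; positivity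
  have hLU : rexp ((1 - θ) * L) = 2 * T := by
    rw [hL, mul_div_cancel₀ _ hθ1'.ne', Real.exp_log (by linarith)]
  have hLl : L + 2 ≤ (2 * q + 2) * l := by
    have h1 : L ≤ q * (2 * l) := by
      rw [hL, hlog2T, hq, one_div_mul_eq_div]
      gcongr
      linarith [Real.log_two_lt_d9]
    linarith
  have hre : ∀ z ∈ s, z.re ≤ 1 := fun z hz => by
    by_contra! h
    exact H.zetaReg_ne_zero h (hs z hz).1
  have hloc := hD₁ T s (by linarith) fun z hz =>
    ⟨(hs z hz).1, by linarith [(hs z hz).2.1], (hs z hz).2.2.1⟩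
  rw [← hl] at hloc
  have key := card_le_of_detect (h := detector ℓ A L) (a := (1 + θ) / 2) (b := 1 + η) (T := T)
    (V := κ * l) (M := K * T ^ (2 + q)) (η := η) (α := α) (G := D₄ * l) s
    (fun z hz => H.differentiableAt_detector L (by linarith)) hη0 hα le_rfl hα1 (by linarith)
    (by linarith) (by positivity)
    (fun z h1 h2 h3 => hK L T z (by linarith) hL h1 (by linarith) h3)
    (fun ρ hρ => ⟨(hs ρ hρ).2.1, hre ρ hρ, (hs ρ hρ).2.2.1, third_le_norm_detector L (hs ρ hρ).1
      (by linarith [(hs ρ hρ).2.1]) (hre ρ hρ) (hs ρ hρ).2.2.2⟩)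
    (fun t => (sum_gaussian_le_of_local hloc t).trans (by rw [hD₄, mul_assoc _ D₁]))
    (by rw [hl]; exact hT₀ T κ hT₀T hκq)
  have hI := hD₂ L (2 * T) hL0 (by linarith) hLU
  have hJ := hD₃ L (2 * T) η hL0 (by linarith) hLU hη0 hη1
  rw [hη'] at hJ
  have e1 : rexp (-(κ * l * (α - (1 + θ) / 2))) * T = T ^ E := by
    have hTl : T = rexp l := by rw [hl, Real.exp_log hT0]
    rw [hTE]
    nth_rewrite 1 [hTl]
    rw [← Real.exp_add]
    congr 1
    have : E = 1 - κ * (α - (1 + θ) / 2) := by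
      rw [hE, hκ]
      field_simp
      rw [hd]; ring
    rw [this]; ring
  have e2 : rexp (2 * (κ * l * (1 + η - α))) ≤ T ^ E * rexp (4 * q) := by
    rw [hTE, ← Real.exp_add]
    apply Real.exp_le_exp.2
    have h1 : E = 2 * κ * (1 - α) := by rw [hE, hκ]; ring
    have h2 : 2 * (κ * l * (1 + η - α)) = 2 * κ * (1 - α) * l + 2 * κ * (l * η) := by ring
    rw [h2, h1, hηl]
    linarith
  have hTE0 : 0 < T ^ E := Real.rpow_pos_of_pos hT0 E
  have f1 : rexp (-(κ * l * (α - (1 + θ) / 2))) *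
      (∫ t in -(2 * T)..2 * T, ‖detector ℓ A L (((1 + θ) / 2 : ℝ) + t * I)‖) ≤
      P * T ^ E * l := by
    calc _ ≤ rexp (-(κ * l * (α - (1 + θ) / 2))) * (D₂ * (2 * T * ((2 * q + 2) * l))) := by
          refine mul_le_mul_of_nonneg_left (hI.trans ?_) (Real.exp_pos _).le
          gcongr
      _ = P * (rexp (-(κ * l * (α - (1 + θ) / 2))) * T) * l := by rw [hP]; ring
      _ = _ := by rw [e1]
  have f2 : rexp 4 / (2 * η) * rexp (2 * (κ * l * (1 + η - α))) *
      (∫ t in -(2 * T)..2 * T, ‖detector ℓ A L ((1 + η : ℝ) + t * I)‖ ^ 2) ≤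
      Q * T ^ E * l ^ 5 := by
    calc _ ≤ rexp 4 / (2 * η) * (T ^ E * rexp (4 * q)) * (D₃ * l ^ 4) := by
          refine mul_le_mul (by gcongr) hJ (intervalIntegral.integral_nonneg (by linarith)
            fun t _ => by positivity) (by positivity)
      _ = rexp 4 / 2 * (1 / η) * (T ^ E * rexp (4 * q)) * (D₃ * l ^ 4) := by
        congr 2; field_simp
      _ = _ := by rw [hη', hQ]; ring
  have f3 : l ≤ l ^ 5 := le_self_pow₀ hl1 (by norm_num)
  have f4 : l ^ 7 ≤ l ^ 9 := pow_le_pow_right₀ hl1 (by norm_num)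
  have f5 : rexp 4 / η * (D₄ * l) = rexp 4 * D₄ * l ^ 2 := by
    rw [div_eq_mul_one_div, hη']; ring
  rw [f5] at key
  have f6 := mul_le_mul_of_nonneg_left (add_le_add f1 f2)
    (by positivity : 0 ≤ rexp 4 * D₄ * l ^ 2)
  have f7 := key.trans f6
  calc (s.card : ℝ) = 2 * ((s.card : ℝ) / 2) := by ring
    _ ≤ 2 * (rexp 4 * D₄ * l ^ 2 * (P * T ^ E * l + Q * T ^ E * l ^ 5)) := by linarith
    _ ≤ 2 * (rexp 4 * D₄ * l ^ 2 * (P * T ^ E * l ^ 5 + Q * T ^ E * l ^ 5)) := by gcongr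
    _ = 2 * (rexp 4 * D₄ * (P + Q)) * T ^ E * l ^ 7 := by ring
    _ ≤ _ := by gcongr

end LogSystem

namespace LogSystem

open MeasureTheory Complex Real

variable {ℓ : (ℕ →₀ ℕ) → ℝ} {θ A C : ℝ} (H : LogSystem ℓ θ A C)
include H

theorem card_zeros_le_rpow : ∃ D, 0 ≤ D ∧ ∀ (α T : ℝ) (s : Finset ℂ),
    (1 + θ) / 2 ≤ α → α ≤ 1 → 2 ≤ T →
    (∀ z ∈ s, zetaReg ℓ A z = 0 ∧ α ≤ z.re ∧ |z.im| ≤ T) →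
    (s.card : ℝ) ≤ D * (T ^ (4 * (1 - α) / (3 - 2 * α - θ)) * Real.log T ^ 9) := by
  have hθ1 := H.theta_lt_one
  have hθ1' : 0 < 1 - θ := by linarith
  obtain ⟨T₀, D₀, hT₀, hD₀0, hD₀⟩ := H.card_zeros_le_of_large
  obtain ⟨D₁, hD₁0, hD₁⟩ := H.local_card_zeros_le
  have hlog2 : 0 < Real.log 2 := Real.log_pos one_lt_two
  obtain ⟨c, hc⟩ : ∃ c, c = D₁ / Real.log 2 ^ 8 := ⟨_, rfl⟩
  have hc0 : 0 ≤ c := by rw [hc]; positivity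
  refine ⟨D₀ + c * (T₀ + 1) + c * (2 * rexp (2 / (1 - θ))) + c, by positivity,
    fun α T s hα hα1 hT hs => ?_⟩
  have hT0 : 0 < T := by linarith
  obtain ⟨l, hl⟩ : ∃ l, l = Real.log T := ⟨_, rfl⟩
  have hl2 : Real.log 2 ≤ l := hl ▸ Real.log_le_log (by norm_num) hT
  have hl0 : 0 < l := by linarith
  obtain ⟨d, hd⟩ : ∃ d, d = 3 - 2 * α - θ := ⟨_, rfl⟩
  have hdθ : 1 - θ ≤ d := by linarith
  have hd0 : 0 < d := by linarith
  obtain ⟨E, hE⟩ : ∃ E, E = 4 * (1 - α) / d := ⟨_, rfl⟩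
  have hE0 : 0 ≤ E := by
    rw [hE]
    exact div_nonneg (by linarith) hd0.le
  have hloc := hD₁ T s hT fun z hz => ⟨(hs z hz).1, hα.trans (hs z hz).2.1, (hs z hz).2.2⟩
  have hbig := hD₀ α T (s.filter fun z => 1 ≤ |z.im|)
  rw [← hd, ← hE, ← hl] at hbig
  rw [← hd, ← hE, ← hl]
  rw [← hl] at hloc
  obtain ⟨R, hR⟩ : ∃ R, R = T ^ E * l ^ 9 := ⟨_, rfl⟩
  have hTE1 : 1 ≤ T ^ E := Real.one_le_rpow (by linarith) hE0
  have hlR : D₁ * l ≤ c * l ^ 9 := by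
    rw [hc, div_mul_eq_mul_div, le_div_iff₀ (by positivity)]
    calc D₁ * l * Real.log 2 ^ 8 ≤ D₁ * l * l ^ 8 := by gcongr
      _ = _ := by ring
  have hl9 : l ^ 9 ≤ R := by
    rw [hR]
    exact le_mul_of_one_le_left (by positivity) hTE1
  have hR0 : 0 ≤ R := by rw [hR]; positivity
  have htriv : (s.card : ℝ) ≤ (T + 1) * (c * l ^ 9) := by
    have h1 := two_mul_card_le_of_local hT0.le (fun z hz => (hs z hz).2.2) hloc
    have h2 : (T + 1) * (D₁ * l) ≤ (T + 1) * (c * l ^ 9) := by gcongr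
    linarith
  have p1 : 0 ≤ D₀ * R := by positivity
  have p2 : 0 ≤ c * (T₀ + 1) * R := by positivity
  have p3 : 0 ≤ c * (2 * rexp (2 / (1 - θ))) * R := by positivity
  have p4 : 0 ≤ c * R := by positivity
  rw [← hR, add_mul, add_mul, add_mul]
  rcases lt_or_ge T T₀ with hTT | hTT
  · have : (s.card : ℝ) ≤ c * (T₀ + 1) * R := by
      calc _ ≤ _ := htriv
        _ ≤ (T₀ + 1) * (c * R) := by gcongr
        _ = _ := by ring
    linarith
  rcases le_or_gt ((1 + θ) / 2 + 1 / l) α with hαl | hαl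
  · have h1 := hbig hαl hα1 hTT fun z hz => by
      rw [Finset.mem_filter] at hz
      exact ⟨(hs z hz.1).1, (hs z hz.1).2.1, (hs z hz.1).2.2, hz.2⟩
    have h2 : ((s.filter fun z => ¬ 1 ≤ |z.im|).card : ℝ) ≤ D₁ * l := by
      refine le_trans ?_ (hloc 0)
      exact_mod_cast Finset.card_le_card fun z hz => by
        rw [Finset.mem_filter] at hz ⊢
        exact ⟨hz.1, by rw [sub_zero]; linarith [not_le.1 hz.2]⟩
    have h3 : (s.card : ℝ) = (s.filter fun z => 1 ≤ |z.im|).card +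
        (s.filter fun z => ¬ 1 ≤ |z.im|).card := by
      exact_mod_cast (Finset.card_filter_add_card_filter_not _).symm
    have h4 : c * l ^ 9 ≤ c * R := by gcongr
    rw [mul_assoc, ← hR] at h1
    linarith
  · have h1 : T ≤ rexp (2 / (1 - θ)) * T ^ E := by
      have hTl : T = rexp l := by rw [hl, Real.exp_log hT0]
      rw [Real.rpow_def_of_pos hT0, ← hl, ← Real.exp_add]
      nth_rewrite 1 [hTl]
      apply Real.exp_le_exp.2
      have e : E = 1 - (2 * α - 1 - θ) / d := by
        rw [hE]
        field_simp
        rw [hd]; ring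
      have h2 : (2 * α - 1 - θ) * l ≤ 2 := by
        have : (2 * α - 1 - θ) * l ≤ (2 * (1 / l)) * l := by gcongr; linarith
        rwa [mul_assoc, one_div_mul_cancel hl0.ne', mul_one] at this
      have h3 : (2 * α - 1 - θ) / d * l ≤ 2 / (1 - θ) := by
        rw [div_mul_eq_mul_div]
        exact div_le_div₀ (by norm_num) h2 hθ1' hdθ
      rw [e]
      linarith
    have : (s.card : ℝ) ≤ c * (2 * rexp (2 / (1 - θ))) * R := by
      calc _ ≤ _ := htriv
        _ ≤ (2 * T) * (c * l ^ 9) := by gcongr; linarith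
        _ ≤ (2 * (rexp (2 / (1 - θ)) * T ^ E)) * (c * l ^ 9) := by gcongr
        _ = _ := by rw [hR]; ring
    linarith

/-- Analytic continuation is unique on the half plane `θ < re s`. -/
theorem eq_zetaCont {Z : ℂ → ℂ} (hZ : ∀ s : ℂ, 1 < s.re → Z s = zetaSeries ℓ s)
    (hZd : DifferentiableOn ℂ (fun s => Z s - (A : ℂ) / (s - 1)) {s | θ < s.re}) {s : ℂ}
    (hs : θ < s.re) (hs1 : s ≠ 1) : Z s = zetaCont ℓ A s := by
  have hθ1 := H.theta_lt_one
  have hopen : IsOpen {z : ℂ | θ < z.re} := isOpen_lt continuous_const Complex.continuous_re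
  have h1 := hZd.analyticOnNhd hopen
  have h2 : DifferentiableOn ℂ (fun s => (A : ℂ) + s * lap ℓ A s) {z : ℂ | θ < z.re} := by
    intro z hz
    have := H.differentiableAt_lap hz
    exact DifferentiableAt.differentiableWithinAt (by fun_prop)
  have hsplit : ∀ z : ℂ, z ≠ 1 → zetaCont ℓ A z = A + z * lap ℓ A z + A / (z - 1) := by
    intro z hz
    have : z - 1 ≠ 0 := sub_ne_zero.2 hz
    unfold zetaCont
    field_simp
    ring
  have h3 : (fun s => Z s - (A : ℂ) / (s - 1)) =ᶠ[nhds 2] fun s => (A : ℂ) + s * lap ℓ A s := by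
    have : {z : ℂ | 1 < z.re} ∈ nhds (2 : ℂ) :=
      (isOpen_lt continuous_const Complex.continuous_re).mem_nhds (by simp)
    filter_upwards [this] with z hz
    have hz1 : z ≠ 1 := by rintro rfl; simp at hz
    rw [hZ z hz, ← H.zetaCont_eq hz, hsplit z hz1]
    ring
  have h4 := h1.eqOn_of_preconnected_of_eventuallyEq (h2.analyticOnNhd hopen)
    (convex_halfSpace_re_gt θ).isPreconnected (z₀ := 2) (by simp; linarith) h3 hs
  rw [hsplit s hs1]
  exact sub_eq_iff_eq_add.1 h4

end LogSystem

/-- Theorem 1.3: the zero-density estimate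
`N(ζ_𝒫; α, T) ≪ T^{4(1-α)/(3-2α-θ)} (log T)^9`, uniformly for `(1+θ)/2 ≤ α ≤ 1`
and `T ≥ 2`. -/
theorem zero_density_estimate
    (θ : ℝ) (hθ0 : 0 ≤ θ) (hθ1 : θ < 1) (S : BeurlingSystem)
    (A : ℝ) (hA : 0 < A)
    (hwb : (fun x : ℝ => (S.Nint x : ℝ) - A * x) =O[atTop] fun x : ℝ => x ^ θ)
    (Z : ℂ → ℂ) (hZ : S.IsZeta θ A Z) :
    ∃ C : ℝ, ∀ α T : ℝ, (1 + θ) / 2 ≤ α → α ≤ 1 → 2 ≤ T →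
      (zeroCount Z α T : ℝ)
        ≤ C * T ^ (4 * (1 - α) / (3 - 2 * α - θ)) * Real.log T ^ 9 := by
  obtain ⟨C, H⟩ := S.exists_logSystem hθ0 hθ1 hA hwb
  obtain ⟨D, hD0, hD⟩ := H.card_zeros_le_rpow
  have hlog2 : 0 < Real.log 2 := Real.log_pos one_lt_two
  refine ⟨D + 1 / Real.log 2 ^ 9, fun α T hα hα1 hT => ?_⟩
  have hl : Real.log 2 ≤ Real.log T := Real.log_le_log (by norm_num) hT
  have hE0 : 0 ≤ 4 * (1 - α) / (3 - 2 * α - θ) := div_nonneg (by linarith) (by linarith)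
  have hTE1 := Real.one_le_rpow (by linarith : 1 ≤ T) hE0
  have hbound := fun s => hD α T s hα hα1 hT
  rw [mul_assoc]
  obtain ⟨R, hR⟩ : ∃ R, R = T ^ (4 * (1 - α) / (3 - 2 * α - θ)) * Real.log T ^ 9 := ⟨_, rfl⟩
  rw [← hR] at hbound ⊢
  have hlR : Real.log 2 ^ 9 ≤ R := by
    have : Real.log 2 ^ 9 ≤ Real.log T ^ 9 := by gcongr
    rw [hR]
    exact this.trans (le_mul_of_one_le_left (pow_nonneg (hlog2.le.trans hl) 9) hTE1)
  have hone : 1 ≤ 1 / Real.log 2 ^ 9 * R := by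
    rw [one_div_mul_eq_div, one_le_div (by positivity)]
    exact hlR
  have hR0 : 0 ≤ R := (by positivity : (0 : ℝ) ≤ Real.log 2 ^ 9).trans hlR
  rw [add_mul]
  have hDR : 0 ≤ D * R := by positivity
  unfold zeroCount
  by_cases hfin : {ρ : ℂ | Z ρ = 0 ∧ α ≤ ρ.re ∧ |ρ.im| ≤ T}.Finite
  · rw [Set.ncard_eq_toFinset_card _ hfin]
    have h1 := hbound (hfin.toFinset.erase 1) fun z hz => by
      rw [Finset.mem_erase, Set.Finite.mem_toFinset] at hz
      obtain ⟨hz1, hz0, hzα, hzT⟩ := hz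
      refine ⟨?_, hzα, hzT⟩
      rw [LogSystem.zetaReg_eq _ _ hz1, ← H.eq_zetaCont
        (fun s hs => (hZ.1 s hs).trans (S.tsum_n_eq s)) hZ.2 (by linarith) hz1, hz0, mul_zero]
    have h2 : (hfin.toFinset.card : ℝ) ≤ (hfin.toFinset.erase 1).card + 1 := by
      exact_mod_cast Nat.sub_le_iff_le_add.1 Finset.pred_card_le_card_erase
    linarith
  · rw [Set.Infinite.ncard hfin]
    push_cast
    linarith
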